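/- arXiv:2106.03608 — 3 statements merged into one kernel-verified Lean document; each statement's English description precedes it below -/
import Mathlib

section
/- Let R be a local domain with maximal ideal m, residue characteristic ≠ 2, and fraction field K. Let V be a 2-dimensional K-vector space and ρ: G → Aut_K(V) a representation of a group G with tr ρ(G) ⊆ R. Assume there exists g₀ ∈ G whose characteristic polynomial under ρ has two roots in R that are distinct modulo m. Then there exists a unique ideal J(ρ) of R such that for every ideal I of R: J(ρ) ⊆ I if and only if there exist characters ϑ, ϑ': G → (R/I)^× with tr ρ mod I = ϑ + ϑ'. -/
open IsLocalRing

/-- The fundamental trace identity for three endomorphisms of a plane. -/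
theorem trace_identity_of_finrank_eq_two {K V : Type*} [Field K] [AddCommGroup V] [Module K V]
    (hdim : Module.finrank K V = 2) (f g h : V →ₗ[K] V) :
    LinearMap.trace K V f * LinearMap.trace K V (g * h) - LinearMap.trace K V (f * g * h)
      - LinearMap.trace K V (f * h * g)
      - LinearMap.trace K V f * LinearMap.trace K V g * LinearMap.trace K V h
      + LinearMap.trace K V g * LinearMap.trace K V (f * h)
      + LinearMap.trace K V (f * g) * LinearMap.trace K V h = 0 := by
  have : Module.Finite K V := Module.finite_of_finrank_pos (by omega)
  let b := Module.finBasisOfFinrankEq K V hdim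
  simp only [LinearMap.trace_eq_matrix_trace K b, LinearMap.toMatrix_mul, Matrix.trace_fin_two,
    Matrix.mul_apply, Fin.sum_univ_two]
  ring

/-- For an endomorphism of a plane, twice the determinant is `(tr f)² - tr (f²)`. -/
theorem two_mul_det_of_finrank_eq_two {K V : Type*} [Field K] [AddCommGroup V] [Module K V]
    (hdim : Module.finrank K V = 2) (f : V →ₗ[K] V) :
    2 * LinearMap.det f = LinearMap.trace K V f ^ 2 - LinearMap.trace K V (f * f) := by
  have : Module.Finite K V := Module.finite_of_finrank_pos (by omega)
  let b := Module.finBasisOfFinrankEq K V hdim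
  rw [← LinearMap.det_toMatrix b]
  simp only [LinearMap.trace_eq_matrix_trace K b, LinearMap.toMatrix_mul, Matrix.trace_fin_two,
    Matrix.det_fin_two, Matrix.mul_apply, Fin.sum_univ_two]
  ring

/-- In a local ring, `2` is a unit if the residue characteristic is not `2`. -/
theorem isUnit_two_of_ringChar_residue_ne_two {R : Type*} [CommRing R] [IsLocalRing R]
    (hchar : ringChar (R ⧸ maximalIdeal R) ≠ 2) : IsUnit (2 : R) := by
  by_contra h
  have h2 : Ideal.Quotient.mk (maximalIdeal R) 2 = 0 :=
    Ideal.Quotient.eq_zero_iff_mem.mpr ((mem_maximalIdeal 2).mpr h)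
  have hdvd : ringChar (R ⧸ maximalIdeal R) ∣ 2 :=
    ringChar.dvd (by rwa [map_ofNat] at h2)
  rcases (Nat.dvd_prime Nat.prime_two).mp hdvd with h1 | h1
  · have := ringChar.spec (R ⧸ maximalIdeal R) 1
    rw [h1] at this
    simp at this
  · exact hchar h1

/-- In a local ring, a monic quadratic whose roots differ by a unit has no other roots. -/
theorem eq_or_eq_of_mul_sub_eq_zero {S : Type*} [CommRing S] [IsLocalRing S] {x r s : S}
    (hrs : IsUnit (r - s)) (h : (x - r) * (x - s) = 0) : x = r ∨ x = s := by
  have hadd : IsUnit ((x - s) + (r - x)) := by simpa using hrs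
  rcases isUnit_or_isUnit_of_isUnit_add hadd with hu | hu
  · exact Or.inl (sub_eq_zero.mp ((hu.mul_left_eq_zero).mp h))
  · rw [← neg_sub x r, IsUnit.neg_iff] at hu
    exact Or.inr (sub_eq_zero.mp ((hu.mul_right_eq_zero).mp h))

/-- Bellaïche–Chenevier. Let `R` be a local domain with residue
characteristic `≠ 2` and fraction field `K`, `V` a two-dimensional `K`-vector space and
`ρ : G → Aut_K(V)` a representation with traces `tr` valued in `R`. Assume there is
`g₀ ∈ G` whose characteristic polynomial (i.e. `X² - tr(ρ g₀) X + det(ρ g₀)`) has two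
roots `λ₁, λ₂ ∈ R` that are distinct modulo the maximal ideal. Then there is a unique
ideal `J(ρ)` of `R` such that for every ideal `I`: `J(ρ) ⊆ I` iff `tr ρ mod I` is the
sum of two characters `ϑ, ϑ' : G → (R/I)ˣ`. -/
theorem exists_unique_ideal_of_reducibility
    {R K V G : Type*} [CommRing R] [IsDomain R] [IsLocalRing R]
    [Field K] [Algebra R K] [IsFractionRing R K]
    [AddCommGroup V] [Module K V] [Group G]
    (hchar : ringChar (R ⧸ maximalIdeal R) ≠ 2)
    (hdim : Module.finrank K V = 2)
    (ρ : Representation K G V)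
    (tr : G → R) (htr : ∀ g, algebraMap R K (tr g) = LinearMap.trace K V (ρ g))
    (g₀ : G) (lam₁ lam₂ : R)
    (hsum : lam₁ + lam₂ = tr g₀)
    (hprod : algebraMap R K (lam₁ * lam₂) = LinearMap.det (ρ g₀))
    (hdist : Ideal.Quotient.mk (maximalIdeal R) lam₁ ≠ Ideal.Quotient.mk (maximalIdeal R) lam₂) :
    ∃! J : Ideal R, ∀ I : Ideal R,
      J ≤ I ↔ ∃ ϑ ϑ' : G →* (R ⧸ I)ˣ,
        ∀ g, Ideal.Quotient.mk I (tr g) = (ϑ g : R ⧸ I) + (ϑ' g : R ⧸ I) := by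
  have : Module.Finite K V := Module.finite_of_finrank_pos (by omega)
  have hinj := IsFractionRing.injective R K
  have htwo : IsUnit (2 : R) := isUnit_two_of_ringChar_residue_ne_two hchar
  have hunit : IsUnit (lam₁ - lam₂) := by
    by_contra h
    exact hdist (Ideal.Quotient.eq.mpr ((mem_maximalIdeal _).mpr h))
  obtain ⟨w, hw⟩ := hunit.exists_right_inv
  have htr_one : tr 1 = 2 := hinj (by
    rw [htr, map_one, LinearMap.trace_one, hdim, map_ofNat, Nat.cast_ofNat])
  have htr_comm (g h : G) : tr (g * h) = tr (h * g) := hinj (by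
    rw [htr, htr, map_mul ρ, map_mul ρ, LinearMap.trace_mul_comm])
  have htr_id (g h : G) : tr g₀ * tr (g * h) - tr (g₀ * (g * h)) - tr (g₀ * (h * g))
      - tr g₀ * tr g * tr h + tr g * tr (g₀ * h) + tr (g₀ * g) * tr h = 0 := hinj (by
    simpa [htr, mul_assoc] using
      trace_identity_of_finrank_eq_two hdim (ρ g₀) (ρ g) (ρ h))
  have htr_sq : 2 * (lam₁ * lam₂) = tr g₀ ^ 2 - tr (g₀ * g₀) := hinj (by
    rw [map_mul, hprod, map_ofNat]
    simpa [htr] using two_mul_det_of_finrank_eq_two hdim (ρ g₀))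
  let a : G → R := fun g ↦ w * (tr (g₀ * g) - lam₂ * tr g)
  let d : G → R := fun g ↦ w * (lam₁ * tr g - tr (g₀ * g))
  have ha_one : a 1 = 1 := by
    simp only [a, mul_one, htr_one]
    linear_combination hw - w * hsum
  have hd_one : d 1 = 1 := by
    simp only [d, mul_one, htr_one]
    linear_combination hw + w * hsum
  have htr_eq (g : G) : tr g = a g + d g := by
    simp only [a, d]
    linear_combination - tr g * hw
  have hd_mul (g h : G) : d (g * h) - d g * d h = a (h * g) - a h * a g := by
    have hid := htr_id g h
    rw [← hsum] at hid
    simp only [a, d, htr_comm h g]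
    linear_combination w * hid - w * ((lam₁ + lam₂) * tr g * tr h - tr g * tr (g₀ * h)
      - tr (g₀ * g) * tr h) * hw
  let J : Ideal R := Ideal.span (Set.range fun p : G × G ↦ a (p.1 * p.2) - a p.1 * a p.2)
  have hJ (I : Ideal R) : J ≤ I ↔ ∃ ϑ ϑ' : G →* (R ⧸ I)ˣ,
      ∀ g, Ideal.Quotient.mk I (tr g) = (ϑ g : R ⧸ I) + (ϑ' g : R ⧸ I) := by
    constructor
    · intro hJI
      have hmem (g h : G) : a (g * h) - a g * a h ∈ I :=
        hJI (Ideal.subset_span ⟨(g, h), rfl⟩)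
      let α : G →* R ⧸ I :=
        { toFun := fun g ↦ Ideal.Quotient.mk I (a g)
          map_one' := by rw [ha_one, map_one]
          map_mul' := fun g h ↦ by
            rw [← map_mul]
            exact Ideal.Quotient.eq.mpr (hmem g h) }
      let δ : G →* R ⧸ I :=
        { toFun := fun g ↦ Ideal.Quotient.mk I (d g)
          map_one' := by rw [hd_one, map_one]
          map_mul' := fun g h ↦ by
            rw [← map_mul]
            exact Ideal.Quotient.eq.mpr (hd_mul g h ▸ hmem h g) }
      refine ⟨α.toHomUnits, δ.toHomUnits, fun g ↦ ?_⟩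
      rw [htr_eq, map_add]
      rfl
    · rintro ⟨ϑ, ϑ', hϑ⟩
      rcases eq_or_ne I ⊤ with rfl | hI
      · exact le_top
      have : Nontrivial (R ⧸ I) := Ideal.Quotient.nontrivial_iff.mpr hI
      have : IsLocalRing (R ⧸ I) :=
        IsLocalRing.of_surjective' (Ideal.Quotient.mk I) Ideal.Quotient.mk_surjective
      set π := Ideal.Quotient.mk I with hπ
      have hπw : (π lam₁ - π lam₂) * π w = 1 := by rw [← map_sub, ← map_mul, hw, map_one]
      have key (χ χ' : G →* (R ⧸ I)ˣ) (hχ : ∀ g, π (tr g) = (χ g : R ⧸ I) + (χ' g : R ⧸ I))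
          (h₁ : (χ g₀ : R ⧸ I) = π lam₁) : J ≤ I := by
        have h₂ : (χ' g₀ : R ⧸ I) = π lam₂ := by
          have := hχ g₀
          rw [← hsum, map_add, h₁] at this
          exact (add_left_cancel this).symm
        have ha (g : G) : π (a g) = (χ g : R ⧸ I) := by
          simp only [a, map_mul, map_sub, hχ, Units.val_mul, h₁, h₂]
          linear_combination (χ g : R ⧸ I) * hπw
        refine Ideal.span_le.mpr ?_
        rintro _ ⟨⟨g, h⟩, rfl⟩
        refine Ideal.Quotient.eq.mp ?_
        rw [← hπ, map_mul π (a g), ha, ha, ha, map_mul, Units.val_mul]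
      have hsum' : π lam₁ + π lam₂ = (ϑ g₀ : R ⧸ I) + (ϑ' g₀ : R ⧸ I) := by
        rw [← map_add, hsum, hϑ]
      have hprod' : π lam₁ * π lam₂ = (ϑ g₀ : R ⧸ I) * (ϑ' g₀ : R ⧸ I) := by
        refine (htwo.map π).mul_left_cancel ?_
        have := congrArg π htr_sq
        simp only [map_mul, map_sub, map_pow, hϑ, Units.val_mul] at this
        rw [this, map_ofNat]
        ring
      have hroot : ((ϑ g₀ : R ⧸ I) - π lam₁) * ((ϑ g₀ : R ⧸ I) - π lam₂) = 0 := by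
        linear_combination hprod' - (ϑ g₀ : R ⧸ I) * hsum'
      have hπunit : IsUnit (π lam₁ - π lam₂) := by simpa using hunit.map π
      rcases eq_or_eq_of_mul_sub_eq_zero hπunit hroot with h | h
      · exact key ϑ ϑ' hϑ h
      · refine key ϑ' ϑ (fun g ↦ by rw [hϑ, add_comm]) ?_
        linear_combination -h - hsum'
  refine ⟨J, hJ, fun J' hJ' ↦ le_antisymm ?_ ?_⟩
  · exact (hJ' J).mpr ((hJ J).mp le_rfl)
  · exact (hJ J').mpr ((hJ' J').mp le_rfl)
end

section
/- Let R be a complete local UFD with residue characteristic ≠ 2, and ρ: G → Aut_K(V) a 2-dimensional irreducible representation admitting a G-stable free lattice, such that tr ρ mod m is the sum of two distinct characters. Then every G-stable reflexive R-lattice of V is free over R. -/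
open IsLocalRing

/-- Over a unique factorization domain, the dual of a module any two of whose functionals are
proportional is free. -/
theorem Module.Dual.free_of_mul_comm {R M : Type*} [CommRing R] [IsDomain R]
    [UniqueFactorizationMonoid R] [AddCommGroup M] [Module R M]
    (h : ∀ (f g : Module.Dual R M) (m n : M), f m * g n = f n * g m) :
    Module.Free R (Module.Dual R M) := by
  by_cases hzero : ∀ f : Module.Dual R M, f = 0
  · have : Subsingleton (Module.Dual R M) := ⟨fun f g ↦ by rw [hzero f, hzero g]⟩
    infer_instance
  push Not at hzero
  obtain ⟨k, hk⟩ := hzero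
  obtain ⟨m₀, hm₀⟩ : ∃ m, k m ≠ 0 := by
    by_contra! hc
    exact hk (LinearMap.ext hc)
  obtain ⟨r, ⟨hr, f₀, hf₀⟩, hmin⟩ :=
    WellFounded.has_min (r := DvdNotUnit (α := R)) wellFounded_dvdNotUnit
      {r : R | r ≠ 0 ∧ ∃ f : Module.Dual R M, f m₀ = r} ⟨k m₀, hm₀, k, rfl⟩
  have hinj (f : Module.Dual R M) (hf : f m₀ = 0) : f = 0 := by
    ext m
    have := h f k m m₀
    rw [hf, zero_mul] at this
    exact (mul_eq_zero.mp this).resolve_right hm₀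
  have hunit (b : R) (hb : ∀ m, b ∣ f₀ m) : IsUnit b := by
    by_contra hbu
    choose q hq using hb
    have hb0 : b ≠ 0 := by
      rintro rfl
      exact hr (by rw [← hf₀, hq, zero_mul])
    let f₁ : Module.Dual R M :=
      { toFun := q
        map_add' := fun x y ↦ mul_left_cancel₀ hb0 (by rw [mul_add, ← hq, ← hq, ← hq, map_add])
        map_smul' := fun c x ↦ mul_left_cancel₀ hb0 (by
          rw [← hq, map_smul, hq x, RingHom.id_apply, smul_eq_mul, smul_eq_mul]; ring) }
    have hq0 : q m₀ ≠ 0 := fun h0 ↦ hr (by rw [← hf₀, hq, h0, mul_zero])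
    exact hmin (q m₀) ⟨hq0, f₁, rfl⟩ ⟨hq0, b, hbu, by rw [← hf₀, hq m₀, mul_comm]⟩
  refine Module.Free.of_equiv
    (LinearEquiv.ofBijective (LinearMap.toSpanSingleton R (Module.Dual R M) f₀) ⟨?_, ?_⟩)
  · rw [injective_iff_map_eq_zero]
    intro a ha
    have := LinearMap.congr_fun ha m₀
    simpa [hf₀, hr] using this
  · intro f
    obtain ⟨b, a, c, hrel, hcb, hca⟩ :=
      UniqueFactorizationMonoid.exists_reduced_factors r hr (f m₀)
    have hc : c ≠ 0 := by
      rintro rfl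
      exact hr (by rw [← hcb, zero_mul])
    have key (m : M) : b * f m = a * f₀ m := by
      have := h f f₀ m m₀
      rw [hf₀, ← hcb, ← hca] at this
      exact mul_left_cancel₀ hc (by linear_combination this)
    obtain ⟨u, rfl⟩ := hunit b fun m ↦ hrel.dvd_of_dvd_mul_left ⟨f m, (key m).symm⟩
    refine ⟨↑u⁻¹ * a, LinearMap.ext fun m ↦ ?_⟩
    have := key m
    simp only [LinearMap.toSpanSingleton_apply, LinearMap.smul_apply, smul_eq_mul]
    rw [mul_assoc, ← this, Units.inv_mul_cancel_left]

/-- A reflexive module of rank at most one over a unique factorization domain is free. -/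
theorem Module.IsReflexive.free_of_rank_le_one {R M : Type*} [CommRing R] [IsDomain R]
    [UniqueFactorizationMonoid R] [AddCommGroup M] [Module R M] [Module.IsReflexive R M]
    (h : ∀ m n : M, ∃ a b : R, (a ≠ 0 ∨ b ≠ 0) ∧ a • m = b • n) :
    Module.Free R M := by
  have hfree : Module.Free R (Module.Dual R (Module.Dual R M)) := by
    have hcomm (f g : Module.Dual R M) (m n : M) : f m * g n = f n * g m := by
      obtain ⟨a, b, hab, hmn⟩ := h m n
      have hf : a * f m = b * f n := by simpa using congrArg f hmn
      have hg : a * g m = b * g n := by simpa using congrArg g hmn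
      rcases hab with ha | hb
      · exact mul_left_cancel₀ ha (by linear_combination g n * hf - f n * hg)
      · exact mul_left_cancel₀ hb (by linear_combination g m * hf - f m * hg)
    refine Module.Dual.free_of_mul_comm fun F G f g ↦ ?_
    obtain ⟨m, rfl⟩ := (Module.bijective_dual_eval R M).2 F
    obtain ⟨n, rfl⟩ := (Module.bijective_dual_eval R M).2 G
    simp only [Module.Dual.eval_apply]
    rw [hcomm f g m n, mul_comm]
  exact Module.Free.of_equiv (Module.evalEquiv R M).symm

theorem Module.End.isCompl_eigenspace_of_isUnit_sub {R M : Type*} [CommRing R] [AddCommGroup M]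
    [Module R M] (φ : Module.End R M) {α β : R} (hu : IsUnit (α - β))
    (hφ : ∀ m, φ (φ m) - (α + β) • φ m + (α * β) • m = 0) :
    IsCompl (φ.eigenspace α) (φ.eigenspace β) := by
  obtain ⟨u, hu⟩ := hu.exists_left_inv
  constructor
  · rw [Submodule.disjoint_def]
    intro m hα hβ
    rw [Module.End.mem_eigenspace_iff] at hα hβ
    have : (α - β) • m = 0 := by rw [sub_smul, ← hα, hβ, sub_self]
    rw [← one_smul R m, ← hu, mul_smul, this, smul_zero]
  · rw [codisjoint_iff, eq_top_iff]
    intro m _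
    rw [Submodule.mem_sup]
    refine ⟨u • (φ m - β • m), ?_, -u • (φ m - α • m), ?_, ?_⟩
    · rw [Module.End.mem_eigenspace_iff]
      simp only [map_smul, map_sub]
      linear_combination (norm := module) u • hφ m
    · rw [Module.End.mem_eigenspace_iff]
      simp only [map_smul, map_sub]
      linear_combination (norm := module) -u • hφ m
    · have : m = (u * (α - β)) • m := by rw [hu, one_smul]
      linear_combination (norm := module) -this

theorem LinearMap.exists_quadratic_of_finrank_eq_two {K V : Type*} [Field K] [AddCommGroup V]
    [Module K V] (hdim : Module.finrank K V = 2) (f : Module.End K V) :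
    ∃ d : K, 2 * d = LinearMap.trace K V f ^ 2 - LinearMap.trace K V (f * f) ∧
      ∀ v, f (f v) - LinearMap.trace K V f • f v + d • v = 0 := by
  have : FiniteDimensional K V := Module.finite_of_finrank_pos (by omega)
  let b := Module.finBasisOfFinrankEq K V hdim
  set A := LinearMap.toMatrix b b f with hA
  have htr : LinearMap.trace K V f = A.trace := LinearMap.trace_eq_matrix_trace K b f
  have htr2 : LinearMap.trace K V (f * f) = (A * A).trace := by
    rw [LinearMap.trace_eq_matrix_trace K b, LinearMap.toMatrix_mul]
  refine ⟨A.det, ?_, fun v ↦ ?_⟩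
  · rw [htr, htr2]
    simp only [Matrix.trace_fin_two, Matrix.det_fin_two, Matrix.mul_apply, Fin.sum_univ_two]
    ring
  · have hmat : A * A - A.trace • A + A.det • (1 : Matrix (Fin 2) (Fin 2) K) = 0 := by
      ext i j
      fin_cases i <;> fin_cases j <;>
        simp [Matrix.trace_fin_two, Matrix.det_fin_two, Matrix.mul_apply] <;> ring
    have hend : f * f - A.trace • f + A.det • (1 : Module.End K V) = 0 := by
      apply (LinearMap.toMatrix b b).injective
      rw [map_add, map_sub, map_smul, map_smul, LinearMap.toMatrix_mul, LinearMap.toMatrix_one,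
        map_zero]
      exact hmat
    rw [htr]
    simpa using LinearMap.congr_fun hend v

/-- An endomorphism of a plane whose trace is not `2 * a` has an `a`-eigenspace of dimension at
most one. -/
theorem LinearMap.exists_smul_eq_smul_of_trace_ne {K V : Type*} [Field K] [AddCommGroup V]
    [Module K V] (hdim : Module.finrank K V = 2) (f : Module.End K V) {a : K}
    (ha : LinearMap.trace K V f ≠ 2 * a) {v w : V} (hv : f v = a • v) (hw : f w = a • w) :
    ∃ x y : K, (x ≠ 0 ∨ y ≠ 0) ∧ x • v = y • w := by
  have : FiniteDimensional K V := Module.finite_of_finrank_pos (by omega)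
  by_contra! hc
  have hli : LinearIndependent K ![v, w] := by
    rw [LinearIndependent.pair_iff]
    intro s t hst
    by_contra hne
    refine hc s (-t) (by simpa [or_iff_not_and_not] using hne) ?_
    rw [neg_smul]
    exact eq_neg_of_add_eq_zero_left hst
  let b := basisOfLinearIndependentOfCardEqFinrank hli (by simp [hdim])
  have hfa : f = a • LinearMap.id := by
    refine b.ext fun i ↦ ?_
    fin_cases i <;> simp [b, hv, hw]
  apply ha
  rw [hfa, map_smul, LinearMap.trace_id, hdim, smul_eq_mul, mul_comm]
  norm_num

/-- Hensel's lemma for a monic quadratic polynomial with distinct roots in the residue field. -/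
theorem exists_roots_of_residue_roots {R : Type*} [CommRing R] [IsLocalRing R]
    [IsAdicComplete (maximalIdeal R) R] {t d a b : R}
    (ht : t - (a + b) ∈ maximalIdeal R) (hd : d - a * b ∈ maximalIdeal R)
    (hab : a - b ∉ maximalIdeal R) :
    ∃ α β : R, IsUnit (α - β) ∧ α + β = t ∧ α * β = d := by
  let p : Polynomial R := .X ^ 2 - .C t * .X + .C d
  have hp : p.Monic := by
    unfold p
    monicity!
  have heval : p.eval a ∈ maximalIdeal R := by
    have : p.eval a = (d - a * b) - a * (t - (a + b)) := by simp [p]; ring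
    rw [this]
    exact sub_mem hd (Ideal.mul_mem_left _ _ ht)
  have hder : p.derivative.eval a ∉ maximalIdeal R := fun hmem ↦ hab <| by
    have : a - b = p.derivative.eval a + (t - (a + b)) := by simp [p]; ring
    rw [this]
    exact add_mem hmem ht
  obtain ⟨α, hα, hαa⟩ := HenselianRing.is_henselian (I := maximalIdeal R) p hp a heval
    ((notMem_maximalIdeal.mp hder).map _)
  refine ⟨α, t - α, ?_, by ring, ?_⟩
  · refine notMem_maximalIdeal.mp fun hmem ↦ hab ?_
    have : a - b = (α - (t - α)) - 2 * (α - a) + (t - (a + b)) := by ring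
    rw [this]
    exact add_mem (sub_mem hmem (Ideal.mul_mem_left _ _ hαa)) ht
  · have : α ^ 2 - t * α + d = 0 := by simpa [p] using hα
    linear_combination -this

/-- A reflexive submodule of a plane stable under an endomorphism whose characteristic polynomial
splits over the base ring, with roots differing by a unit, is free. -/
theorem Submodule.free_of_isReflexive_of_eigenvalues {R K V : Type*} [CommRing R] [IsDomain R]
    [UniqueFactorizationMonoid R] [Field K] [Algebra R K] [IsFractionRing R K]
    [AddCommGroup V] [Module K V] [Module R V] [IsScalarTower R K V]
    (hdim : Module.finrank K V = 2) (f : Module.End K V) {α β : R} (hu : IsUnit (α - β))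
    (htr : LinearMap.trace K V f = algebraMap R K (α + β))
    (hf : ∀ v, f (f v) - (α + β) • f v + (α * β) • v = 0)
    (T : Submodule R V) [Module.IsReflexive R T] (hT : ∀ v ∈ T, f v ∈ T) :
    Module.Free R T := by
  let φ : Module.End R T := (f.restrictScalars R).restrict hT
  have hcompl : IsCompl (φ.eigenspace α) (φ.eigenspace β) :=
    Module.End.isCompl_eigenspace_of_isUnit_sub φ hu fun m ↦ Subtype.ext (hf m)
  have hne : algebraMap R K α ≠ algebraMap R K β := fun h ↦ by
    rw [IsFractionRing.injective R K h, sub_self] at hu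
    exact not_isUnit_zero hu
  have hfree (γ : R) (N : Submodule R T) (hN : IsCompl (φ.eigenspace γ) N)
      (hγ : LinearMap.trace K V f ≠ 2 * algebraMap R K γ) :
      Module.Free R (φ.eigenspace γ) := by
    have : Module.IsReflexive R (φ.eigenspace γ) :=
      Module.IsReflexive.of_split (φ.eigenspace γ).subtype
        (Submodule.projectionOnto _ _ hN) (Submodule.projectionOnto_comp_subtype hN)
    refine Module.IsReflexive.free_of_rank_le_one fun m n ↦ ?_
    have heig (m : φ.eigenspace γ) : f (m : T) = algebraMap R K γ • ((m : T) : V) := by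
      rw [algebraMap_smul]
      exact congrArg Subtype.val (Module.End.mem_eigenspace_iff.mp m.2)
    obtain ⟨x, y, hxy, hmn⟩ := LinearMap.exists_smul_eq_smul_of_trace_ne hdim f hγ (heig m) (heig n)
    obtain ⟨s, hs⟩ := IsLocalization.exist_integer_multiples_of_finite (nonZeroDivisors R) ![x, y]
    obtain ⟨a, ha⟩ := hs 0
    obtain ⟨b, hb⟩ := hs 1
    change _ = (s : R) • x at ha
    change _ = (s : R) • y at hb
    have hs0 : algebraMap R K s ≠ 0 := IsFractionRing.to_map_ne_zero_of_mem_nonZeroDivisors s.2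
    rw [Algebra.smul_def] at ha hb
    refine ⟨a, b, ?_, ?_⟩
    · refine hxy.imp (fun hx h0 ↦ ?_) (fun hy h0 ↦ ?_)
      · rw [h0, map_zero] at ha
        exact mul_ne_zero hs0 hx ha.symm
      · rw [h0, map_zero] at hb
        exact mul_ne_zero hs0 hy hb.symm
    · apply Subtype.ext
      apply Subtype.ext
      change a • ((m : T) : V) = b • ((n : T) : V)
      rw [← algebraMap_smul K a, ← algebraMap_smul K b, ha, hb, mul_smul, mul_smul, hmn]
  have hα := hfree α _ hcompl fun h ↦ hne (by rw [htr, map_add] at h; linear_combination -h)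
  have hβ := hfree β _ hcompl.symm fun h ↦ hne (by rw [htr, map_add] at h; linear_combination h)
  exact Module.Free.of_equiv (Submodule.prodEquivOfIsCompl _ _ hcompl)

open IsLocalRing

/-- Let `R` be a complete local UFD with residue characteristic `≠ 2`,
and `ρ : G → Aut_K(V)` a two-dimensional irreducible representation admitting a `G`-stable
free lattice, such that `tr ρ mod m` is the sum of two distinct characters. Then every
`G`-stable reflexive `R`-lattice of `V` is free over `R`. -/
theorem stable_reflexive_lattice_free
    {R K V G : Type*} [CommRing R] [IsDomain R] [IsLocalRing R]
    [UniqueFactorizationMonoid R] [IsAdicComplete (maximalIdeal R) R]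
    [Field K] [Algebra R K] [IsFractionRing R K]
    [AddCommGroup V] [Module K V] [Module R V] [IsScalarTower R K V] [Group G]
    (hchar : ringChar (R ⧸ maximalIdeal R) ≠ 2)
    (hdim : Module.finrank K V = 2)
    (ρ : Representation K G V)
    (hirr : ∀ W : Submodule K V, (∀ g : G, ∀ v ∈ W, ρ g v ∈ W) → W = ⊥ ∨ W = ⊤)
    (T₀ : Submodule R V) (hT₀fg : T₀.FG) (hT₀span : Submodule.span K (T₀ : Set V) = ⊤)
    (hT₀stab : ∀ g : G, ∀ v ∈ T₀, ρ g v ∈ T₀) (hT₀free : Module.Free R T₀)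
    (tr : G → R) (htr : ∀ g, algebraMap R K (tr g) = LinearMap.trace K V (ρ g))
    (ψ ψ' : G →* (R ⧸ maximalIdeal R)ˣ) (hdist : ψ ≠ ψ')
    (hred : ∀ g, Ideal.Quotient.mk (maximalIdeal R) (tr g)
      = (ψ g : R ⧸ maximalIdeal R) + (ψ' g : R ⧸ maximalIdeal R)) :
    ∀ T : Submodule R V,
      T.FG → Submodule.span K (T : Set V) = ⊤ → (∀ g : G, ∀ v ∈ T, ρ g v ∈ T) →
      Function.Bijective (Module.Dual.eval R T) →
      Module.Free R T := by
  intro T _ _ hTstab hTrefl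
  have : Module.IsReflexive R T := ⟨hTrefl⟩
  obtain ⟨g, hg⟩ : ∃ g, ψ g ≠ ψ' g := by
    by_contra! h
    exact hdist (MonoidHom.ext h)
  have htwo : IsUnit (2 : R) := by
    refine notMem_maximalIdeal.mp fun hmem ↦ Ring.two_ne_zero hchar ?_
    rw [← map_ofNat (Ideal.Quotient.mk (maximalIdeal R)) 2]
    exact Ideal.Quotient.eq_zero_iff_mem.mpr hmem
  obtain ⟨c, hc⟩ := htwo.exists_left_inv
  obtain ⟨a, ha⟩ := Ideal.Quotient.mk_surjective (ψ g : R ⧸ maximalIdeal R)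
  obtain ⟨b, hb⟩ := Ideal.Quotient.mk_surjective (ψ' g : R ⧸ maximalIdeal R)
  have hg2 : Ideal.Quotient.mk (maximalIdeal R) (tr (g * g)) =
      Ideal.Quotient.mk (maximalIdeal R) (a * a + b * b) := by
    rw [hred, map_mul, map_mul, map_add, map_mul, map_mul, ha, hb, Units.val_mul, Units.val_mul]
  have hg1 : Ideal.Quotient.mk (maximalIdeal R) (tr g) =
      Ideal.Quotient.mk (maximalIdeal R) (a + b) := by
    rw [hred, map_add, ha, hb]
  rw [Ideal.Quotient.eq] at hg1 hg2
  obtain ⟨α, β, hu, hsum, hprod⟩ :=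
    exists_roots_of_residue_roots (t := tr g) (d := c * (tr g ^ 2 - tr (g * g))) (a := a) (b := b)
      hg1
      (by
        have : c * (tr g ^ 2 - tr (g * g)) - a * b =
            c * (tr g + (a + b)) * (tr g - (a + b)) - c * (tr (g * g) - (a * a + b * b)) := by
          linear_combination a * b * hc
        rw [this]
        exact sub_mem (Ideal.mul_mem_left _ _ hg1) (Ideal.mul_mem_left _ _ hg2))
      (fun hmem ↦ hg <| Units.ext <| by
        rw [← ha, ← hb]
        exact Ideal.Quotient.eq.mpr hmem)
  obtain ⟨d, hd, hquad⟩ := LinearMap.exists_quadratic_of_finrank_eq_two hdim (ρ g)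
  have hdet : d = algebraMap R K (α * β) := by
    rw [← map_mul, ← htr, ← htr, ← map_pow, ← map_sub] at hd
    have hcK : algebraMap R K c * 2 = 1 := by
      rw [← map_ofNat (algebraMap R K) 2, ← map_mul, hc, map_one]
    rw [hprod, map_mul, ← hd, ← mul_assoc, hcK, one_mul]
  refine Submodule.free_of_isReflexive_of_eigenvalues hdim (ρ g) hu (by rw [hsum, htr])
    (fun v ↦ ?_) T (hTstab g)
  have := hquad v
  rwa [hdet, ← htr, algebraMap_smul, algebraMap_smul, ← hsum] at this
end

section
/- Let R be a complete local UFD with residue characteristic ≠ 2 and ρ: G → Aut_K(V) a 2-dimensional irreducible representation with a stable free lattice and residually disjoint reducible reduction (tr ρ mod m = ψ + ψ' with ψ ≠ ψ'). Let J be the ideal of reducibility and let N = {𝔭₁,…,𝔭_r} be the height-one primes with J_{𝔭ᵢ} ⊊ R_{𝔭ᵢ}, with nᵢ = ord_{𝔭ᵢ} J_{𝔭ᵢ}. Then the graph C^fr(ρ) of homothety classes of stable free lattices (edges given by quotients with characteristic ideal a height-one prime) is isomorphic to the r-dimensional rectangle graph with vertex set ∏ᵢ {0,…,nᵢ} and edges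 between vertices differing by 1 in exactly one coordinate. If N is empty, C^fr(ρ) is a single point. -/
open IsLocalRing

/-- A prime ideal of height one. -/
def IsHeightOnePrime {R : Type*} [CommRing R] (p : Ideal R) : Prop :=
  p.IsPrime ∧ p ≠ ⊥ ∧ ∀ q : Ideal R, q.IsPrime → q < p → q = ⊥

/-- Scaling of an `R`-lattice by `x : K`. -/
noncomputable def latSmul (R K : Type*) {V : Type*} [CommRing R] [Field K] [Algebra R K]
    [AddCommGroup V] [Module K V] [Module R V] [IsScalarTower R K V]
    (x : K) (T : Submodule R V) : Submodule R V :=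
  Submodule.map ((LinearMap.lsmul K V x).restrictScalars R) T

/-- Homothety of lattices. -/
def Homothetic (R K : Type*) {V : Type*} [CommRing R] [Field K] [Algebra R K]
    [AddCommGroup V] [Module K V] [Module R V] [IsScalarTower R K V]
    (T T' : Submodule R V) : Prop :=
  ∃ x : K, x ≠ 0 ∧ latSmul R K x T = T'

/-- The quotient `T'/T` of two lattices `T ≤ T'`, as an `R`-module. -/
abbrev quotMod {R V : Type*} [CommRing R] [AddCommGroup V] [Module R V]
    (T T' : Submodule R V) : Type _ :=
  T' ⧸ Submodule.comap T'.subtype T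

/-- There is an edge from `[T]` to `[T']` in `C^fr(ρ)` if some representatives satisfy
`S ≤ S'` with `S'/S` of characteristic ideal a height-one prime (i.e. `S'/S ≅ R/q`). -/
def EdgeLat (R K : Type*) {V : Type*} [CommRing R] [Field K] [Algebra R K]
    [AddCommGroup V] [Module K V] [Module R V] [IsScalarTower R K V]
    (T T' : Submodule R V) : Prop :=
  ∃ S S' : Submodule R V, Homothetic R K T S ∧ Homothetic R K T' S' ∧ S ≤ S' ∧
    ∃ q : Ideal R, IsHeightOnePrime q ∧ Nonempty (quotMod S S' ≃ₗ[R] R ⧸ q)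

/-- Adjacency in the rectangle graph: the vertices differ by `1` in exactly one
coordinate. -/
def RectAdj {r : ℕ} {n : Fin r → ℕ} (j j' : ∀ i, Fin (n i + 1)) : Prop :=
  ∃ s, ((j s : ℤ) - (j' s : ℤ)).natAbs = 1 ∧ ∀ i, i ≠ s → j i = j' i

section Divisors

variable {R : Type*} [CommRing R] [UniqueFactorizationMonoid R]

/-- A nonempty family of elements of a UFD has a greatest common divisor. -/
lemma exists_gcd_family {ι : Type*} (f : ι → R) (hf : ∃ i, f i ≠ 0) :
    ∃ c, c ≠ 0 ∧ (∀ i, c ∣ f i) ∧ ∀ x, (∀ i, x ∣ f i) → x ∣ c := by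
  classical
  let _ : GCDMonoid R := UniqueFactorizationMonoid.toGCDMonoid R
  obtain ⟨i₀, hi₀⟩ := hf
  let S : Set R := {c | c ≠ 0 ∧ ∀ x, (∀ i, x ∣ f i) → x ∣ c}
  have hS : S.Nonempty := ⟨f i₀, hi₀, fun x hx => hx i₀⟩
  obtain ⟨c, ⟨hc0, hc⟩, hmin⟩ :=
    (IsWellFounded.wf (α := R) (r := DvdNotUnit)).has_min S hS
  refine ⟨c, hc0, fun i => ?_, hc⟩
  have hg0 : gcd c (f i) ≠ 0 := fun h => hc0 ((gcd_eq_zero_iff _ _).1 h).1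
  have hg : gcd c (f i) ∈ S := ⟨hg0, fun x hx => dvd_gcd (hc x hx) (hx i)⟩
  by_contra hci
  refine hmin _ hg (dvdNotUnit_of_dvd_of_not_dvd (gcd_dvd_left _ _) fun h => ?_)
  exact hci (h.trans (gcd_dvd_right _ _))

variable [IsDomain R] {r : ℕ} {π : Fin r → R} {n : Fin r → ℕ} {d : R}

/-- The vector of multiplicities of `x` at the primes `π i`, truncated at `n i`. -/
noncomputable def truncMultiplicity (π : Fin r → R) (n : Fin r → ℕ) (x : R) :
    ∀ i, Fin (n i + 1) :=
  fun i => ⟨min (multiplicity (π i) x) (n i), Nat.lt_succ_of_le (min_le_right _ _)⟩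

lemma truncMultiplicity_apply (hπ : ∀ i, Prime (π i)) (hd : d ≠ 0)
    (hdn : ∀ i, ¬ π i ^ (n i + 1) ∣ d) {x : R} (hx : x ∣ d) (i : Fin r) :
    (truncMultiplicity π n x i : ℕ) = multiplicity (π i) x := by
  refine min_eq_left (Nat.le_of_lt_succ ?_)
  have hfin := FiniteMultiplicity.of_prime_left (hπ i) (ne_zero_of_dvd_ne_zero hd hx)
  rw [hfin.multiplicity_lt_iff_not_dvd]
  exact fun h => hdn i (h.trans hx)

lemma dvd_of_multiplicity_le (hπ : ∀ i, Prime (π i)) {x y : R} (hx : x ≠ 0) (hy : y ≠ 0)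
    (hxp : ∀ q, Prime q → q ∣ x → ∃ i, Associated q (π i))
    (h : ∀ i, multiplicity (π i) x ≤ multiplicity (π i) y) : x ∣ y := by
  rw [UniqueFactorizationMonoid.dvd_iff_emultiplicity_le hx]
  intro q hq
  by_cases hqx : q ∣ x
  · obtain ⟨i, hi⟩ := hxp q hq hqx
    rw [← emultiplicity_eq_of_associated_left hi, ← emultiplicity_eq_of_associated_left hi,
      (FiniteMultiplicity.of_prime_left (hπ i) hx).emultiplicity_eq_multiplicity,
      (FiniteMultiplicity.of_prime_left (hπ i) hy).emultiplicity_eq_multiplicity]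
    exact_mod_cast h i
  · rw [emultiplicity_eq_zero.2 hqx]
    exact zero_le

lemma associated_of_multiplicity_eq (hπ : ∀ i, Prime (π i)) {x y : R} (hx : x ≠ 0) (hy : y ≠ 0)
    (hxp : ∀ q, Prime q → q ∣ x → ∃ i, Associated q (π i))
    (hyp : ∀ q, Prime q → q ∣ y → ∃ i, Associated q (π i))
    (h : ∀ i, multiplicity (π i) x = multiplicity (π i) y) : Associated x y :=
  associated_of_dvd_dvd (dvd_of_multiplicity_le hπ hx hy hxp fun i => (h i).le)
    (dvd_of_multiplicity_le hπ hy hx hyp fun i => (h i).ge)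

lemma truncMultiplicity_eq_iff (hπ : ∀ i, Prime (π i)) (hd : d ≠ 0)
    (hdn : ∀ i, ¬ π i ^ (n i + 1) ∣ d)
    (hdp : ∀ q, Prime q → q ∣ d → ∃ i, Associated q (π i)) {x y : R} (hx : x ∣ d) (hy : y ∣ d) :
    truncMultiplicity π n x = truncMultiplicity π n y ↔ Associated x y := by
  constructor
  · intro h
    refine associated_of_multiplicity_eq hπ (ne_zero_of_dvd_ne_zero hd hx)
      (ne_zero_of_dvd_ne_zero hd hy) (fun q hq h => hdp q hq (h.trans hx))
      (fun q hq h => hdp q hq (h.trans hy)) fun i => ?_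
    rw [← truncMultiplicity_apply hπ hd hdn hx, ← truncMultiplicity_apply hπ hd hdn hy, h]
  · intro h
    funext i
    ext
    rw [truncMultiplicity_apply hπ hd hdn hx, truncMultiplicity_apply hπ hd hdn hy]
    exact multiplicity_eq_of_associated_right h

lemma multiplicity_prime_mul (hπ : ∀ i, Prime (π i))
    (hπi : ∀ i j, Associated (π i) (π j) → i = j) {x : R} (hx : x ≠ 0) (s i : Fin r) :
    multiplicity (π i) (π s * x) = multiplicity (π i) x + if i = s then 1 else 0 := by
  rw [multiplicity_mul (hπ i)
    (FiniteMultiplicity.of_prime_left (hπ i) (mul_ne_zero (hπ s).ne_zero hx)), add_comm]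
  congr 1
  split_ifs with h
  · subst h
    simp
  · rw [multiplicity_eq_zero]
    exact fun hd => h (hπi _ _ ((hπ i).associated_of_dvd (hπ s) hd))

lemma exists_truncMultiplicity_eq (hπ : ∀ i, Prime (π i))
    (hπi : ∀ i j, Associated (π i) (π j) → i = j) (hd : d ≠ 0)
    (hdn : ∀ i, π i ^ n i ∣ d ∧ ¬ π i ^ (n i + 1) ∣ d)
    (j : ∀ i, Fin (n i + 1)) : ∃ x, x ∣ d ∧ truncMultiplicity π n x = j := by
  have key : ∀ S : Finset (Fin r), ∀ i,
      multiplicity (π i) (∏ s ∈ S, π s ^ (j s : ℕ)) = if i ∈ S then (j i : ℕ) else 0 := by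
    intro S i
    have hne : ∏ s ∈ S, π s ^ (j s : ℕ) ≠ 0 :=
      Finset.prod_ne_zero_iff.2 fun s _ => pow_ne_zero _ (hπ s).ne_zero
    have h1 : emultiplicity (π i) (∏ s ∈ S, π s ^ (j s : ℕ))
        = ∑ s ∈ S, if i = s then ((j s : ℕ) : ℕ∞) else 0 := by
      rw [Finset.emultiplicity_prod (hπ i)]
      refine Finset.sum_congr rfl fun s _ => ?_
      split_ifs with h
      · subst h
        exact emultiplicity_pow_self_of_prime (hπ i) _
      · rw [emultiplicity_eq_zero]
        exact fun hd => h (hπi _ _ ((hπ i).associated_of_dvd (hπ s) ((hπ i).dvd_of_dvd_pow hd)))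
    rw [(FiniteMultiplicity.of_prime_left (hπ i) hne).emultiplicity_eq_multiplicity,
      Finset.sum_ite_eq] at h1
    split_ifs at h1 ⊢ <;> exact_mod_cast h1
  have hxd : ∏ s, π s ^ (j s : ℕ) ∣ d := by
    refine dvd_of_multiplicity_le hπ
      (Finset.prod_ne_zero_iff.2 fun s _ => pow_ne_zero _ (hπ s).ne_zero) hd ?_ fun i => ?_
    · intro q hq h
      obtain ⟨s, -, hs⟩ := (Prime.dvd_finsetProd_iff hq _).1 h
      exact ⟨s, hq.associated_of_dvd (hπ s) (hq.dvd_of_dvd_pow hs)⟩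
    · rw [key]
      simp only [Finset.mem_univ, if_true]
      exact (FiniteMultiplicity.of_prime_left (hπ i) hd).le_multiplicity_of_pow_dvd
        ((pow_dvd_pow _ (Nat.le_of_lt_succ (j i).2)).trans (hdn i).1)
  refine ⟨_, hxd, ?_⟩
  funext i
  ext
  rw [truncMultiplicity_apply hπ hd (fun i => (hdn i).2) hxd, key]
  simp

lemma RectAdj.symm {j j' : ∀ i, Fin (n i + 1)} (h : RectAdj j j') : RectAdj j' j := by
  obtain ⟨s, hs, h⟩ := h
  exact ⟨s, by omega, fun i hi => (h i hi).symm⟩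

lemma rectAdj_of_associated (hπ : ∀ i, Prime (π i))
    (hπi : ∀ i j, Associated (π i) (π j) → i = j) (hd : d ≠ 0)
    (hdn : ∀ i, ¬ π i ^ (n i + 1) ∣ d)
    (hdp : ∀ q, Prime q → q ∣ d → ∃ i, Associated q (π i)) {x y q : R} (hx : x ∣ d) (hy : y ∣ d)
    (hq : Prime q) (h : Associated y (q * x)) :
    RectAdj (truncMultiplicity π n x) (truncMultiplicity π n y) := by
  obtain ⟨s, hs⟩ := hdp q hq ((dvd_mul_right q x).trans (h.dvd'.trans hy))
  have hm : ∀ i, multiplicity (π i) y = multiplicity (π i) x + if i = s then 1 else 0 := by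
    intro i
    rw [← multiplicity_prime_mul hπ hπi (ne_zero_of_dvd_ne_zero hd hx)]
    exact multiplicity_eq_of_associated_right (h.trans (hs.mul_right x))
  refine ⟨s, ?_, fun i hi => ?_⟩
  · rw [truncMultiplicity_apply hπ hd hdn hx, truncMultiplicity_apply hπ hd hdn hy, hm]
    simp
  · ext
    rw [truncMultiplicity_apply hπ hd hdn hx, truncMultiplicity_apply hπ hd hdn hy, hm]
    simp [hi]

lemma associated_of_rectAdj (hπ : ∀ i, Prime (π i))
    (hπi : ∀ i j, Associated (π i) (π j) → i = j) (hd : d ≠ 0)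
    (hdn : ∀ i, ¬ π i ^ (n i + 1) ∣ d)
    (hdp : ∀ q, Prime q → q ∣ d → ∃ i, Associated q (π i)) {x y : R} (hx : x ∣ d) (hy : y ∣ d)
    {s : Fin r}
    (hs : (truncMultiplicity π n y s : ℕ) = truncMultiplicity π n x s + 1)
    (hi : ∀ i, i ≠ s → truncMultiplicity π n x i = truncMultiplicity π n y i) :
    Associated y (π s * x) := by
  have hx0 := ne_zero_of_dvd_ne_zero hd hx
  refine associated_of_multiplicity_eq hπ (ne_zero_of_dvd_ne_zero hd hy)
    (mul_ne_zero (hπ s).ne_zero hx0) (fun q hq h => hdp q hq (h.trans hy)) ?_ fun i => ?_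
  · intro q hq h
    rcases hq.dvd_or_dvd h with h | h
    · exact ⟨s, hq.associated_of_dvd (hπ s) h⟩
    · exact hdp q hq (h.trans hx)
  · rw [multiplicity_prime_mul hπ hπi hx0, ← truncMultiplicity_apply hπ hd hdn hx,
      ← truncMultiplicity_apply hπ hd hdn hy]
    split_ifs with h
    · rw [h, hs]
    · rw [hi i h, add_zero]

/-- Two divisors of `d` have adjacent multiplicity vectors iff they differ by a prime factor. -/
lemma rectAdj_truncMultiplicity_iff (hπ : ∀ i, Prime (π i))
    (hπi : ∀ i j, Associated (π i) (π j) → i = j) (hd : d ≠ 0)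
    (hdn : ∀ i, ¬ π i ^ (n i + 1) ∣ d)
    (hdp : ∀ q, Prime q → q ∣ d → ∃ i, Associated q (π i)) {x y : R} (hx : x ∣ d) (hy : y ∣ d) :
    RectAdj (truncMultiplicity π n x) (truncMultiplicity π n y) ↔
      ∃ q, Prime q ∧ (Associated y (q * x) ∨ Associated x (q * y)) := by
  constructor
  · rintro ⟨s, hs, hi⟩
    refine ⟨π s, hπ s, ?_⟩
    rcases Int.natAbs_eq_iff.1 hs with h | h
    · exact .inr (associated_of_rectAdj hπ hπi hd hdn hdp hy hx (by push_cast at h; omega)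
        fun i h => (hi i h).symm)
    · exact .inl (associated_of_rectAdj hπ hπi hd hdn hdp hx hy (by push_cast at h; omega) hi)
  · rintro ⟨q, hq, h | h⟩
    · exact rectAdj_of_associated hπ hπi hd hdn hdp hx hy hq h
    · exact (rectAdj_of_associated hπ hπi hd hdn hdp hy hx hq h).symm

end Divisors

section DiagonalLattices

variable {R K V : Type*} [CommRing R] [Field K] [Algebra R K]
  [AddCommGroup V] [Module K V] [Module R V] [IsScalarTower R K V]

variable (R) in
/-- The lattice `R x e₀ + R y e₁` attached to a basis `(e₀, e₁)`. -/
def diagLattice (b : Module.Basis (Fin 2) K V) (x y : K) : Submodule R V :=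
  Submodule.span R {x • b 0, y • b 1}

variable {b : Module.Basis (Fin 2) K V}

lemma repr_smul_of_tower (r : R) (w : V) (i : Fin 2) :
    b.repr (r • w) i = algebraMap R K r * b.repr w i := by
  rw [← algebraMap_smul K r, map_smul, Finsupp.smul_apply, smul_eq_mul]

lemma mem_diagLattice {x y : K} {w : V} :
    w ∈ diagLattice R b x y ↔ (∃ r : R, b.repr w 0 = algebraMap R K r * x) ∧
      ∃ s : R, b.repr w 1 = algebraMap R K s * y := by
  rw [diagLattice, Submodule.mem_span_pair]
  constructor
  · rintro ⟨r, s, rfl⟩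
    refine ⟨⟨r, ?_⟩, ⟨s, ?_⟩⟩ <;>
    simp [repr_smul_of_tower]
  · rintro ⟨⟨r, hr⟩, ⟨s, hs⟩⟩
    refine ⟨r, s, ?_⟩
    rw [← b.sum_repr w, Fin.sum_univ_two, hr, hs, ← algebraMap_smul K r, ← algebraMap_smul K s,
      smul_smul, smul_smul]

omit [Algebra R K] [IsScalarTower R K V] in
lemma diagLattice_fg (x y : K) : (diagLattice R b x y).FG :=
  Submodule.fg_span (by simp)

lemma span_diagLattice {x y : K} (hx : x ≠ 0) (hy : y ≠ 0) :
    Submodule.span K (diagLattice R b x y : Set V) = ⊤ := by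
  rw [diagLattice, Submodule.span_span_of_tower, eq_top_iff, ← b.span_eq, Submodule.span_le]
  rintro _ ⟨i, rfl⟩
  have h0 : x • b 0 ∈ Submodule.span K {x • b 0, y • b 1} := Submodule.subset_span (by simp)
  have h1 : y • b 1 ∈ Submodule.span K {x • b 0, y • b 1} := Submodule.subset_span (by simp)
  fin_cases i
  · simpa [smul_smul, hx] using Submodule.smul_mem _ x⁻¹ h0
  · simpa [smul_smul, hy] using Submodule.smul_mem _ y⁻¹ h1

lemma diagLattice_le_iff {x y x' y' : K} :
    diagLattice R b x y ≤ diagLattice R b x' y' ↔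
      (∃ r : R, x = algebraMap R K r * x') ∧ ∃ s : R, y = algebraMap R K s * y' := by
  rw [diagLattice, Submodule.span_le, Set.insert_subset_iff, Set.singleton_subset_iff,
    SetLike.mem_coe, SetLike.mem_coe, mem_diagLattice, mem_diagLattice]
  constructor
  · rintro ⟨⟨h, -⟩, -, h'⟩
    exact ⟨by simpa using h, by simpa using h'⟩
  · rintro ⟨h, h'⟩
    exact ⟨⟨by simpa using h, 0, by simp⟩, ⟨0, by simp⟩, by simpa using h'⟩

lemma latSmul_diagLattice (c x y : K) :
    latSmul R K c (diagLattice R b x y) = diagLattice R b (c * x) (c * y) := by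
  simp [latSmul, diagLattice, Submodule.map_span, Set.image_pair, smul_smul, mul_comm]

/-- Stability of a diagonal lattice under an endomorphism with integral matrix. -/
lemma diagLattice_stable_imp {f : V →ₗ[K] V} {A B C D : R}
    (h0 : f (b 0) = A • b 0 + C • b 1) (h1 : f (b 1) = B • b 0 + D • b 1) {a y : K} (ha : a ≠ 0)
    (hst : ∀ w ∈ diagLattice R b a (a * y), f w ∈ diagLattice R b a (a * y)) :
    (∃ r : R, algebraMap R K B * y = algebraMap R K r) ∧
      ∃ s : R, algebraMap R K C = algebraMap R K s * y := by
  have m0 := hst (a • b 0) (Submodule.subset_span (by simp))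
  have m1 := hst ((a * y) • b 1) (Submodule.subset_span (by simp))
  rw [map_smul, h0, mem_diagLattice] at m0
  rw [map_smul, h1, mem_diagLattice] at m1
  obtain ⟨-, s, hs⟩ := m0
  obtain ⟨⟨r, hr⟩, -⟩ := m1
  simp [repr_smul_of_tower] at hs hr
  exact ⟨⟨r, mul_left_cancel₀ ha (by linear_combination hr)⟩,
    ⟨s, mul_left_cancel₀ ha (by linear_combination hs)⟩⟩

lemma diagLattice_stable {f : V →ₗ[K] V} {A B C D : R}
    (h0 : f (b 0) = A • b 0 + C • b 1) (h1 : f (b 1) = B • b 0 + D • b 1) (a : K) {x : R}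
    (hx : x ∣ C) :
    ∀ w ∈ diagLattice R b a (a * algebraMap R K x),
      f w ∈ diagLattice R b a (a * algebraMap R K x) := by
  obtain ⟨c, rfl⟩ := hx
  intro w hw
  obtain ⟨⟨r, hr⟩, s, hs⟩ := mem_diagLattice.1 hw
  have hfw : f w = b.repr w 0 • (algebraMap R K A • b 0 + algebraMap R K (x * c) • b 1)
      + b.repr w 1 • (algebraMap R K B • b 0 + algebraMap R K D • b 1) := by
    conv_lhs => rw [← b.sum_repr w, Fin.sum_univ_two, map_add, map_smul, map_smul, h0, h1]
    simp only [algebraMap_smul]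
  rw [hfw, hr, hs, mem_diagLattice]
  refine ⟨⟨r * A + s * x * B, ?_⟩, ⟨r * c + s * D, ?_⟩⟩
  · simp [repr_smul_of_tower]; ring
  · simp [repr_smul_of_tower]; ring

variable [IsFractionRing R K]

lemma diagLattice_free {x y : K} (hx : x ≠ 0) (hy : y ≠ 0) :
    Module.Free R (diagLattice R b x y) := by
  have hli : LinearIndependent K ![x • b 0, y • b 1] := by
    rw [LinearIndependent.pair_iff]
    intro s t h
    have h0 := congrArg (fun w => b.repr w 0) h
    have h1 := congrArg (fun w => b.repr w 1) h
    simp [hx, hy] at h0 h1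
    exact ⟨h0, h1⟩
  have hli' : LinearIndependent R ![x • b 0, y • b 1] :=
    (LinearIndependent.iff_fractionRing R K).2 hli
  have := Module.Free.of_basis (Module.Basis.span hli')
  rwa [Matrix.range_cons_cons_empty] at this

variable [IsDomain R]

/-- Two diagonal lattices are homothetic iff their ratios are associated. -/
lemma homothetic_diagLattice_iff {a a' : K} (ha : a ≠ 0) (ha' : a' ≠ 0) {x x' : R} :
    Homothetic R K (diagLattice R b a (a * algebraMap R K x))
      (diagLattice R b a' (a' * algebraMap R K x')) ↔ Associated x x' := by
  have hinj := IsFractionRing.injective R K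
  constructor
  · rintro ⟨c, hc, h⟩
    rw [latSmul_diagLattice] at h
    obtain ⟨⟨r, hr⟩, s, hs⟩ := diagLattice_le_iff.1 h.le
    obtain ⟨⟨r', hr'⟩, s', hs'⟩ := diagLattice_le_iff.1 h.ge
    have e1 : r * x = s * x' := hinj <| mul_right_cancel₀ ha' <| by
      push_cast [map_mul]
      linear_combination hs - algebraMap R K x * hr
    have e2 : r' * x' = s' * x := hinj <| mul_right_cancel₀ (mul_ne_zero hc ha) <| by
      push_cast [map_mul]
      linear_combination hs' - algebraMap R K x' * hr'
    have e3 : r * r' = 1 := hinj <| mul_right_cancel₀ ha' <| by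
      push_cast [map_mul, map_one]
      linear_combination -hr' - algebraMap R K r' * hr
    refine associated_of_dvd_dvd ⟨r * s', ?_⟩ ⟨r' * s, ?_⟩
    · linear_combination r * e2 - x' * e3
    · linear_combination r' * e1 - x * e3
  · rintro ⟨u, rfl⟩
    refine ⟨a' / a, div_ne_zero ha' ha, ?_⟩
    rw [latSmul_diagLattice]
    have hu : algebraMap R K ((u⁻¹ : Rˣ) : R) * algebraMap R K (u : R) = 1 := by
      rw [← map_mul, Units.inv_mul, map_one]
    apply le_antisymm <;> rw [diagLattice_le_iff]
    · refine ⟨⟨1, by field_simp; simp⟩, ((u⁻¹ : Rˣ) : R), ?_⟩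
      rw [map_mul]
      field_simp
      linear_combination (-algebraMap R K x) * hu
    · refine ⟨⟨1, by field_simp; simp⟩, (u : R), ?_⟩
      rw [map_mul]
      field_simp

end DiagonalLattices

section Edges

/-- `S'/S` is isomorphic to `R/q` iff it is generated by one element with annihilator `q`. -/
lemma nonempty_quotMod_equiv_iff {R V : Type*} [CommRing R] [AddCommGroup V] [Module R V]
    {S S' : Submodule R V} {q : Ideal R} :
    Nonempty (quotMod S S' ≃ₗ[R] R ⧸ q) ↔
      ∃ t ∈ S', (∀ u ∈ S', ∃ k : R, u - k • t ∈ S) ∧ ∀ k : R, k • t ∈ S ↔ k ∈ q := by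
  constructor
  · rintro ⟨e⟩
    obtain ⟨t, ht⟩ := Submodule.Quotient.mk_surjective _ (e.symm (Submodule.Quotient.mk 1))
    have hk : ∀ k : R, (e (Submodule.Quotient.mk (k • t)) : R ⧸ q) = Submodule.Quotient.mk k := by
      intro k
      rw [Submodule.Quotient.mk_smul, map_smul, ht, e.apply_symm_apply,
        ← Submodule.Quotient.mk_smul, smul_eq_mul, mul_one]
    refine ⟨t, t.2, fun u hu => ?_, fun k => ?_⟩
    · obtain ⟨k, hk'⟩ := Submodule.Quotient.mk_surjective _ (e (Submodule.Quotient.mk ⟨u, hu⟩))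
      refine ⟨k, ?_⟩
      have h := e.injective ((hk k).trans hk').symm
      rw [Submodule.Quotient.eq] at h
      simpa using h
    · rw [← Submodule.Quotient.mk_eq_zero q (x := k), ← hk, e.map_eq_zero_iff,
        Submodule.Quotient.mk_eq_zero]
      simp
  · rintro ⟨t, ht, hgen, hann⟩
    let f : R →ₗ[R] quotMod S S' :=
      (Submodule.mkQ _).comp (LinearMap.toSpanSingleton R S' ⟨t, ht⟩)
    have hf : Function.Surjective f := by
      intro u
      obtain ⟨⟨u, hu⟩, rfl⟩ := Submodule.mkQ_surjective _ u
      obtain ⟨k, hk⟩ := hgen u hu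
      refine ⟨k, ?_⟩
      symm
      simpa [f, Submodule.Quotient.eq, ← Submodule.Quotient.mk_smul] using hk
    have hker : LinearMap.ker f = q := by
      ext k
      rw [← hann k]
      simp [f]
    exact ⟨((Submodule.quotEquivOfEq _ _ hker.symm).trans
      (f.quotKerEquivOfSurjective hf)).symm⟩

lemma isHeightOnePrime_span_singleton {R : Type*} [CommRing R] [IsDomain R]
    [UniqueFactorizationMonoid R] {s : R} (hs : Prime s) : IsHeightOnePrime (Ideal.span {s}) := by
  refine ⟨(Ideal.span_singleton_prime hs.ne_zero).2 hs, by simpa using hs.ne_zero,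
    fun q hq hlt => ?_⟩
  by_contra hne
  obtain ⟨x, hxq, hx⟩ := hq.exists_mem_prime_of_ne_bot hne
  have hsx : Associated s x :=
    hs.associated_of_dvd hx (Ideal.mem_span_singleton.1 (hlt.le hxq))
  refine hlt.not_ge ?_
  rw [Ideal.span_singleton_le_iff_mem]
  exact (hsx.dvd_iff_dvd_left.1 dvd_rfl : x ∣ s).elim fun c hc => hc ▸ q.mul_mem_right c hxq

lemma IsHeightOnePrime.exists_eq_span {R : Type*} [CommRing R] [IsDomain R]
    [UniqueFactorizationMonoid R] {q : Ideal R} (hq : IsHeightOnePrime q) :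
    ∃ s, Prime s ∧ q = Ideal.span {s} := by
  obtain ⟨hqp, hq0, hmin⟩ := hq
  obtain ⟨s, hsq, hs⟩ := hqp.exists_mem_prime_of_ne_bot hq0
  refine ⟨s, hs, ?_⟩
  by_contra hne
  have hle : Ideal.span {s} ≤ q := (Ideal.span_singleton_le_iff_mem _).2 hsq
  have := hmin _ ((Ideal.span_singleton_prime hs.ne_zero).2 hs) (lt_of_le_of_ne hle (Ne.symm hne))
  exact hs.ne_zero (by simpa using this)

lemma IsLocalRing.isUnit_of_add_mul_eq_one {R : Type*} [CommRing R] [IsLocalRing R] {x y z : R}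
    (h : x + y * z = 1) (hy : ¬ IsUnit y) : IsUnit x :=
  (IsLocalRing.isUnit_or_isUnit_of_add_one h).resolve_right
    fun hu => hy (isUnit_of_mul_isUnit_left hu)

variable {R K V : Type*} [CommRing R] [IsDomain R] [IsLocalRing R] [Field K] [Algebra R K]
  [IsFractionRing R K] [AddCommGroup V] [Module K V] [Module R V] [IsScalarTower R K V]
  {b : Module.Basis (Fin 2) K V}

omit [IsDomain R] in
lemma exists_prime_of_quotMod_equiv {c c' : K} (hc' : c' ≠ 0) {x x' : R} (hx' : x' ≠ 0)
    (hle : diagLattice R b c (c * algebraMap R K x) ≤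
      diagLattice R b c' (c' * algebraMap R K x')) {q : Ideal R} (hq : q.IsPrime) (hq0 : q ≠ ⊥)
    (e : Nonempty (quotMod (diagLattice R b c (c * algebraMap R K x))
      (diagLattice R b c' (c' * algebraMap R K x')) ≃ₗ[R] R ⧸ q)) :
    ∃ s : R, Prime s ∧ (Associated x (s * x') ∨ Associated x' (s * x)) := by
  have hinj := IsFractionRing.injective R K
  have hX' : algebraMap R K x' ≠ 0 := by simpa using hx'
  obtain ⟨⟨r, hr⟩, s, hs⟩ := diagLattice_le_iff.1 hle
  rw [hs, hr] at e
  have hrs : r * x = s * x' := hinj <| mul_right_cancel₀ hc' <| by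
    push_cast [map_mul]
    linear_combination hs - algebraMap R K x * hr
  obtain ⟨t, ht, hgen, hann⟩ := nonempty_quotMod_equiv_iff.1 e
  have mem : ∀ {w : V} {α β : R}, b.repr w 0 = algebraMap R K α * c' →
      b.repr w 1 = algebraMap R K β * (c' * algebraMap R K x') →
      (w ∈ diagLattice R b (algebraMap R K r * c')
        (algebraMap R K s * (c' * algebraMap R K x')) ↔ r ∣ α ∧ s ∣ β) := by
    intro w α β hα hβ
    rw [mem_diagLattice, hα, hβ]
    simp_rw [← mul_assoc _ (algebraMap R K r), ← mul_assoc _ (algebraMap R K s), ← map_mul,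
      mul_left_inj' hc', mul_left_inj' (mul_ne_zero hc' hX'), hinj.eq_iff, mul_comm _ r,
      mul_comm _ s]
    rfl
  obtain ⟨⟨α, hα⟩, β, hβ⟩ := mem_diagLattice.1 ht
  have hann' : ∀ k : R, k ∈ q ↔ r ∣ k * α ∧ s ∣ k * β := by
    intro k
    rw [← hann, mem (α := k * α) (β := k * β)]
    · rw [repr_smul_of_tower, hα, map_mul, mul_assoc]
    · rw [repr_smul_of_tower, hβ, map_mul, mul_assoc]
  obtain ⟨k₀, hk₀⟩ := hgen (c' • b 0) (Submodule.subset_span (by simp))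
  obtain ⟨k₁, hk₁⟩ := hgen ((c' * algebraMap R K x') • b 1) (Submodule.subset_span (by simp))
  rw [mem (α := 1 - k₀ * α) (β := - (k₀ * β))
    (by simp [repr_smul_of_tower, hα]; ring) (by simp [repr_smul_of_tower, hβ]; ring)] at hk₀
  rw [mem (α := - (k₁ * α)) (β := 1 - k₁ * β)
    (by simp [repr_smul_of_tower, hα]; ring) (by simp [repr_smul_of_tower, hβ]; ring)] at hk₁
  obtain ⟨⟨m₀, h00⟩, m₁, h01⟩ := hk₀
  obtain ⟨⟨m₂, h10⟩, m₃, h11⟩ := hk₁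
  have hspan : ∀ {y z : R}, IsUnit z → (∀ k, k ∈ q ↔ y ∣ k * z) → Prime y := by
    intro y z hz h
    have hqy : q = Ideal.span {y} := by
      ext k
      rw [h, Ideal.mem_span_singleton, hz.dvd_mul_right]
    subst hqy
    exact (Ideal.span_singleton_prime (by simpa using hq0)).1 hq
  by_cases hru : IsUnit r
  · have hsu : ¬ IsUnit s := fun hsu =>
      hq.ne_top ((Ideal.eq_top_iff_one _).2 ((hann' 1).2 ⟨hru.dvd, hsu.dvd⟩))
    have hβu : IsUnit β := isUnit_of_mul_isUnit_right
      (IsLocalRing.isUnit_of_add_mul_eq_one (x := k₁ * β) (by rw [← h11]; ring) hsu)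
    refine ⟨s, hspan hβu fun k => (hann' k).trans (and_iff_right hru.dvd), .inl ?_⟩
    rw [← hrs]
    exact associated_unit_mul_right x r hru
  · have hku := IsLocalRing.isUnit_of_add_mul_eq_one (x := k₀ * α) (by rw [← h00]; ring) hru
    have hαu := isUnit_of_mul_isUnit_right hku
    have hsu : IsUnit s := by
      by_contra hsu
      have hβu := isUnit_of_mul_isUnit_right
        (IsLocalRing.isUnit_of_add_mul_eq_one (x := k₁ * β) (by rw [← h11]; ring) hsu)
      refine hsu (isUnit_of_mul_isUnit_left (y := m₁) ?_)
      rw [← h01]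
      exact ((isUnit_of_mul_isUnit_left hku).mul hβu).neg
    refine ⟨r, hspan hαu fun k => (hann' k).trans (and_iff_left hsu.dvd), .inr ?_⟩
    rw [hrs]
    exact associated_unit_mul_right x' s hsu

variable [UniqueFactorizationMonoid R]

omit [IsLocalRing R] in
lemma edgeLat_of_associated {a a' : K} (ha : a ≠ 0) (ha' : a' ≠ 0) {x x' s : R} (hx : x ≠ 0)
    (hs : Prime s) (h : Associated x' (s * x)) :
    EdgeLat R K (diagLattice R b a' (a' * algebraMap R K x'))
      (diagLattice R b a (a * algebraMap R K x)) := by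
  have hinj := IsFractionRing.injective R K
  have hX : algebraMap R K x ≠ 0 := by simpa using hx
  refine ⟨diagLattice R b a (a * algebraMap R K (s * x)), diagLattice R b a (a * algebraMap R K x),
    (homothetic_diagLattice_iff ha' ha).2 h, (homothetic_diagLattice_iff ha ha).2 (.refl _),
    diagLattice_le_iff.2 ⟨⟨1, by simp⟩, s, by rw [map_mul]; ring⟩, Ideal.span {s},
    isHeightOnePrime_span_singleton hs, nonempty_quotMod_equiv_iff.2 ?_⟩
  refine ⟨(a * algebraMap R K x) • b 1, Submodule.subset_span (by simp), fun u hu => ?_,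
    fun k => ?_⟩
  · obtain ⟨⟨α, hα⟩, β, hβ⟩ := mem_diagLattice.1 hu
    refine ⟨β, mem_diagLattice.2 ⟨⟨α, ?_⟩, 0, ?_⟩⟩
    · simp [repr_smul_of_tower, hα]
    · simp [repr_smul_of_tower, hβ]
  · rw [mem_diagLattice, Ideal.mem_span_singleton]
    simp only [repr_smul_of_tower, map_smul, Finsupp.smul_apply, Module.Basis.repr_self,
      smul_eq_mul]
    constructor
    · rintro ⟨-, m, hm⟩
      refine ⟨m, hinj <| mul_right_cancel₀ (mul_ne_zero ha hX) ?_⟩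
      simp at hm
      rw [map_mul]
      linear_combination hm
    · rintro ⟨m, rfl⟩
      exact ⟨⟨0, by simp⟩, m, by simp; ring⟩

/-- Adjacency of diagonal lattices in terms of their ratios. -/
lemma edgeLat_diagLattice_iff {a a' : K} (ha : a ≠ 0) (ha' : a' ≠ 0) {x x' : R} (hx : x ≠ 0)
    (hx' : x' ≠ 0) :
    (EdgeLat R K (diagLattice R b a (a * algebraMap R K x))
        (diagLattice R b a' (a' * algebraMap R K x')) ∨
      EdgeLat R K (diagLattice R b a' (a' * algebraMap R K x'))
        (diagLattice R b a (a * algebraMap R K x))) ↔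
      ∃ q, Prime q ∧ (Associated x' (q * x) ∨ Associated x (q * x')) := by
  have key : ∀ {a a' : K}, a ≠ 0 → a' ≠ 0 → ∀ {x x' : R}, x' ≠ 0 →
      EdgeLat R K (diagLattice R b a (a * algebraMap R K x))
        (diagLattice R b a' (a' * algebraMap R K x')) →
      ∃ s : R, Prime s ∧ (Associated x (s * x') ∨ Associated x' (s * x)) := by
    rintro a a' ha ha' x x' hx' ⟨_, _, ⟨c, hc, rfl⟩, ⟨c', hc', rfl⟩, hle, q, hq, e⟩
    rw [latSmul_diagLattice, latSmul_diagLattice, ← mul_assoc c, ← mul_assoc c'] at hle e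
    exact exists_prime_of_quotMod_equiv (mul_ne_zero hc' ha') hx' hle hq.1 hq.2.1 e
  constructor
  · rintro (h | h)
    · obtain ⟨s, hs, h⟩ := key ha ha' hx' h
      exact ⟨s, hs, h.symm⟩
    · exact key ha' ha hx h
  · rintro ⟨q, hq, h | h⟩
    · exact .inr (edgeLat_of_associated ha ha' hx hq h)
    · exact .inl (edgeLat_of_associated ha' ha hx' hq h)

end Edges

section Splitting

variable {R K V : Type*} [CommRing R] [IsLocalRing R] [Field K] [Algebra R K]
  [IsFractionRing R K] [AddCommGroup V] [Module K V] [Module R V] [IsScalarTower R K V]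
  {b : Module.Basis (Fin 2) K V}

omit [IsLocalRing R] [IsFractionRing R K] in
lemma eq_diagLattice_of_isUnit {T : Submodule R V} {t₀ t₁ : V} (hT : T = Submodule.span R {t₀, t₁})
    (hproj : ∀ w ∈ T, b.repr w 0 • b 0 ∈ T)
    (hΔ : b.repr t₀ 0 * b.repr t₁ 1 - b.repr t₁ 0 * b.repr t₀ 1 ≠ 0) {x y z w : R}
    (h₀ : b.repr t₀ 0 • b 0 = x • t₀ + z • t₁) (h₁ : b.repr t₁ 0 • b 0 = y • t₀ + w • t₁)
    (hx : IsUnit x) :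
    ∃ u v : K, u ≠ 0 ∧ v ≠ 0 ∧ T = diagLattice R b u v := by
  have e₀₀ := congrArg (fun v => b.repr v 0) h₀
  have e₀₁ := congrArg (fun v => b.repr v 1) h₀
  have e₁₀ := congrArg (fun v => b.repr v 0) h₁
  have e₁₁ := congrArg (fun v => b.repr v 1) h₁
  simp [repr_smul_of_tower] at e₀₀ e₀₁ e₁₀ e₁₁
  obtain ⟨x', hx'⟩ := hx.exists_left_inv
  have hx'K : algebraMap R K x' * algebraMap R K x = 1 := by rw [← map_mul, hx', map_one]
  have hxΔ : algebraMap R K x * (b.repr t₀ 0 * b.repr t₁ 1 - b.repr t₁ 0 * b.repr t₀ 1)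
      = b.repr t₀ 0 * b.repr t₁ 1 := by
    linear_combination -b.repr t₁ 1 * e₀₀ + b.repr t₁ 0 * e₀₁
  have hyΔ : algebraMap R K y * (b.repr t₀ 0 * b.repr t₁ 1 - b.repr t₁ 0 * b.repr t₀ 1)
      = b.repr t₁ 0 * b.repr t₁ 1 := by
    linear_combination -b.repr t₁ 1 * e₁₀ + b.repr t₁ 0 * e₁₁
  have hxy : b.repr t₁ 0 = algebraMap R K (x' * y) * b.repr t₀ 0 := by
    refine mul_left_cancel₀ hΔ ?_
    rw [map_mul]
    linear_combination (-algebraMap R K x' * b.repr t₀ 0) * hyΔ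
      + (algebraMap R K x' * b.repr t₁ 0) * hxΔ
      - b.repr t₁ 0 * (b.repr t₀ 0 * b.repr t₁ 1 - b.repr t₁ 0 * b.repr t₀ 1) * hx'K
  have hne : b.repr t₀ 0 * b.repr t₁ 1 ≠ 0 := by
    rw [← hxΔ]
    exact mul_ne_zero (right_ne_zero_of_mul_eq_one hx'K) hΔ
  have ht₀ : t₀ ∈ T := hT ▸ Submodule.subset_span (by simp)
  have ht₁ : t₁ ∈ T := hT ▸ Submodule.subset_span (by simp)
  refine ⟨b.repr t₀ 0, b.repr t₁ 1, left_ne_zero_of_mul hne, right_ne_zero_of_mul hne,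
    le_antisymm ?_ ?_⟩
  · conv_lhs => rw [hT]
    rw [Submodule.span_le, Set.insert_subset_iff, Set.singleton_subset_iff, SetLike.mem_coe,
      SetLike.mem_coe, mem_diagLattice, mem_diagLattice]
    refine ⟨⟨⟨1, by simp⟩, -(x' * z), ?_⟩, ⟨x' * y, hxy⟩, 1, by simp⟩
    rw [map_neg, map_mul]
    linear_combination (-b.repr t₀ 1) * hx'K - algebraMap R K x' * e₀₁
  · rw [diagLattice, Submodule.span_le, Set.insert_subset_iff, Set.singleton_subset_iff]
    refine ⟨hproj _ ht₀, ?_⟩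
    have : b.repr t₁ 1 • b 1 = t₁ - b.repr t₁ 0 • b 0 := by
      rw [eq_sub_iff_add_eq, add_comm, ← Fin.sum_univ_two (f := fun i => b.repr t₁ i • b i),
        b.sum_repr]
    rw [this]
    exact T.sub_mem ht₁ (hproj _ ht₁)

omit [IsLocalRing R] in
lemma span_range_coe_basis {ι : Type*} {T : Submodule R V} (c : Module.Basis ι R T) :
    Submodule.span R (Set.range fun i => (c i : V)) = T := by
  have := congrArg (Submodule.map T.subtype) c.span_eq
  rw [Submodule.map_span, Submodule.map_top, Submodule.range_subtype, ← Set.range_comp] at this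
  exact this

omit [IsLocalRing R] in
variable (K) in
lemma linearIndependent_coe_basis {ι : Type*} {T : Submodule R V} (c : Module.Basis ι R T) :
    LinearIndependent K (fun i => (c i : V)) :=
  (LinearIndependent.iff_fractionRing R K).1 (c.linearIndependent.map' T.subtype T.ker_subtype)

omit [IsLocalRing R] [IsFractionRing R K] in
lemma top_le_span_coe_basis {ι : Type*} {T : Submodule R V}
    (hspan : Submodule.span K (T : Set V) = ⊤) (c : Module.Basis ι R T) :
    ⊤ ≤ Submodule.span K (Set.range fun i => (c i : V)) := by
  rw [← hspan, Submodule.span_le]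
  nth_rw 1 [← span_range_coe_basis c]
  exact Submodule.span_le_restrictScalars R K _

/-- A free lattice stable under the projections to the coordinate lines is diagonal. -/
lemma exists_eq_diagLattice {T : Submodule R V} (hfg : T.FG)
    (hspan : Submodule.span K (T : Set V) = ⊤) (hfree : Module.Free R T)
    (hproj : ∀ w ∈ T, b.repr w 0 • b 0 ∈ T) :
    ∃ u v : K, u ≠ 0 ∧ v ≠ 0 ∧ T = diagLattice R b u v := by
  have : Module.Finite R T := Module.Finite.iff_fg.2 hfg
  let c₀ := Module.Free.chooseBasis R T
  have hcard : Fintype.card (Module.Free.ChooseBasisIndex R T) = 2 := by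
    have h1 := Module.finrank_eq_card_basis (Module.Basis.mk
      (linearIndependent_coe_basis K c₀) (top_le_span_coe_basis hspan c₀))
    rw [← h1, Module.finrank_eq_card_basis b, Fintype.card_fin]
  let c := c₀.reindex (Fintype.equivFinOfCardEq hcard)
  let cK := Module.Basis.mk (linearIndependent_coe_basis K c) (top_le_span_coe_basis hspan c)
  have hΔ := (b.isUnit_det cK).ne_zero
  rw [b.det_apply, Matrix.det_fin_two] at hΔ
  simp only [Module.Basis.toMatrix_apply, cK, Module.Basis.coe_mk] at hΔ
  have hT : T = Submodule.span R {(c 0 : V), (c 1 : V)} := by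
    nth_rw 1 [← span_range_coe_basis c]
    congr 1
    ext v
    simp [Fin.exists_fin_two, eq_comm]
  have hex : ∀ w ∈ T, ∃ r s : R, w = r • (c 0 : V) + s • (c 1 : V) := by
    intro w hw
    rw [hT, Submodule.mem_span_pair] at hw
    obtain ⟨r, s, h⟩ := hw
    exact ⟨r, s, h.symm⟩
  obtain ⟨x, z, h₀⟩ := hex _ (hproj _ (c 0).2)
  obtain ⟨y, w, h₁⟩ := hex _ (hproj _ (c 1).2)
  have hxw : x + w = 1 := by
    have e₀₀ := congrArg (fun v => b.repr v 0) h₀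
    have e₀₁ := congrArg (fun v => b.repr v 1) h₀
    have e₁₀ := congrArg (fun v => b.repr v 0) h₁
    have e₁₁ := congrArg (fun v => b.repr v 1) h₁
    simp [repr_smul_of_tower] at e₀₀ e₀₁ e₁₀ e₁₁
    refine IsFractionRing.injective R K (mul_right_cancel₀ hΔ ?_)
    rw [map_add, (algebraMap R K).map_one]
    linear_combination -b.repr (c 1) 1 * e₀₀ + b.repr (c 1) 0 * e₀₁ + b.repr (c 0) 1 * e₁₀
      - b.repr (c 0) 0 * e₁₁
  rcases IsLocalRing.isUnit_or_isUnit_of_add_one hxw with hx | hw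
  · exact eq_diagLattice_of_isUnit hT hproj hΔ h₀ h₁ hx
  · refine eq_diagLattice_of_isUnit (hT.trans (by rw [Set.pair_comm])) hproj ?_
      (h₁.trans (add_comm _ _)) (h₀.trans (add_comm _ _)) hw
    contrapose! hΔ
    linear_combination -hΔ

end Splitting

section Eigenbasis

variable {K V : Type*} [Field K] [AddCommGroup V] [Module K V]

lemma cayleyHamilton_of_finrank_two (hdim : Module.finrank K V = 2) (f : V →ₗ[K] V) {l m : K}
    (h2 : (2 : K) ≠ 0) (htr : LinearMap.trace K V f = l + m)
    (htr2 : LinearMap.trace K V (f ∘ₗ f) = l ^ 2 + m ^ 2) (v : V) :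
    f (f v) - (l + m) • f v + (l * m) • v = 0 := by
  have : FiniteDimensional K V := .of_finrank_pos (by omega)
  let b := Module.finBasisOfFinrankEq K V hdim
  let M := LinearMap.toMatrix b b f
  rw [LinearMap.trace_eq_matrix_trace K b] at htr htr2
  rw [LinearMap.toMatrix_comp b b b] at htr2
  change M.trace = _ at htr
  change (M * M).trace = _ at htr2
  simp only [Matrix.trace_fin_two, Matrix.mul_apply, Fin.sum_univ_two] at htr htr2
  have hM : M * M - (l + m) • M + (l * m) • 1 = 0 := by
    have hdet : M 0 0 * M 1 1 - M 0 1 * M 1 0 = l * m := mul_left_cancel₀ h2 <| by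
      linear_combination (M 0 0 + M 1 1 + l + m) * htr - htr2
    ext i j
    fin_cases i <;> fin_cases j <;>
      simp [Matrix.mul_apply, Fin.sum_univ_two]
    · linear_combination M 0 0 * htr - hdet
    · linear_combination M 0 1 * htr
    · linear_combination M 1 0 * htr
    · linear_combination M 1 1 * htr - hdet
  have hf : f ∘ₗ f - (l + m) • f + (l * m) • LinearMap.id = 0 := by
    apply (LinearMap.toMatrix b b).injective
    rw [map_add, map_sub, map_smul, map_smul, LinearMap.toMatrix_comp b b b, LinearMap.toMatrix_id,
      map_zero]
    exact hM
  simpa using LinearMap.congr_fun hf v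

lemma exists_eigenbasis (hdim : Module.finrank K V = 2) (f : V →ₗ[K] V) {l m : K} (hlm : l ≠ m)
    (h2 : (2 : K) ≠ 0) (htr : LinearMap.trace K V f = l + m)
    (htr2 : LinearMap.trace K V (f ∘ₗ f) = l ^ 2 + m ^ 2) :
    ∃ b : Module.Basis (Fin 2) K V, f (b 0) = l • b 0 ∧ f (b 1) = m • b 1 := by
  have : FiniteDimensional K V := .of_finrank_pos (by omega)
  have hCH := cayleyHamilton_of_finrank_two hdim f h2 htr htr2
  have hex : ∀ k : K, l + m ≠ k * 2 → ∃ w, f w - k • w ≠ 0 := by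
    intro k hk
    by_contra! h
    have hf : f = k • LinearMap.id := LinearMap.ext fun w => by simpa using sub_eq_zero.1 (h w)
    rw [hf, map_smul, LinearMap.trace_id, hdim] at htr
    exact hk (by rw [← htr]; simp)
  obtain ⟨w, hw⟩ := hex m fun h => hlm (by linear_combination h)
  obtain ⟨w', hw'⟩ := hex l fun h => hlm (by linear_combination -h)
  have hv : f (f w - m • w) = l • (f w - m • w) := by
    rw [← sub_eq_zero, ← hCH w, map_sub, map_smul]
    module
  have hv' : f (f w' - l • w') = m • (f w' - l • w') := by
    rw [← sub_eq_zero, ← hCH w', map_sub, map_smul]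
    module
  have hli : LinearIndependent K ![f w - m • w, f w' - l • w'] := by
    rw [LinearIndependent.pair_iff]
    intro s t h
    have h' := congrArg f h
    rw [map_add, map_smul, map_smul, hv, hv', map_zero] at h'
    have hs : (s * (l - m)) • (f w - m • w) = 0 := by
      rw [show (s * (l - m)) • (f w - m • w) = (s • l • (f w - m • w) + t • m • (f w' - l • w'))
        - m • (s • (f w - m • w) + t • (f w' - l • w')) by module, h', h, smul_zero, sub_zero]
    have ht : (t * (m - l)) • (f w' - l • w') = 0 := by
      rw [show (t * (m - l)) • (f w' - l • w') = (s • l • (f w - m • w) + t • m • (f w' - l • w'))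
        - l • (s • (f w - m • w) + t • (f w' - l • w')) by module, h', h, smul_zero, sub_zero]
    simp only [smul_eq_zero, mul_eq_zero, sub_eq_zero, hw, hw', or_false, hlm, hlm.symm] at hs ht
    exact ⟨hs, ht⟩
  refine ⟨basisOfLinearIndependentOfCardEqFinrank hli (by simp [hdim]), ?_, ?_⟩
  · simpa using hv
  · simpa using hv'

end Eigenbasis

section Reducibility

variable {R : Type*} [CommRing R] [IsLocalRing R]

lemma isUnit_two_of_ringChar_ne_two (h : ringChar (R ⧸ maximalIdeal R) ≠ 2) : IsUnit (2 : R) := by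
  have h2 : (2 : R ⧸ maximalIdeal R) ≠ 0 := by
    let _ := Ideal.Quotient.field (maximalIdeal R)
    exact Ring.two_ne_zero h
  by_contra hu
  refine h2 ?_
  rw [← map_ofNat (Ideal.Quotient.mk (maximalIdeal R)) 2, Ideal.Quotient.eq_zero_iff_mem]
  exact (mem_maximalIdeal _).2 hu

/-- Power sums `t` and `s` which are residually those of two distinct elements lift to power sums
of two residually distinct elements. -/
lemma exists_lift_roots [IsAdicComplete (maximalIdeal R) R] (h2 : IsUnit (2 : R)) {t s : R}
    {α β : R ⧸ maximalIdeal R} (hαβ : α ≠ β)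
    (ht : Ideal.Quotient.mk (maximalIdeal R) t = α + β)
    (hs : Ideal.Quotient.mk (maximalIdeal R) s = α ^ 2 + β ^ 2) :
    ∃ l m : R, IsUnit (l - m) ∧ t = l + m ∧ s = l ^ 2 + m ^ 2 := by
  obtain ⟨v, hv⟩ := h2.exists_left_inv
  let δ := v * (t ^ 2 - s)
  let f : Polynomial R := .X ^ 2 - .C t * .X + .C δ
  obtain ⟨a, rfl⟩ := Ideal.Quotient.mk_surjective α
  obtain ⟨a', rfl⟩ := Ideal.Quotient.mk_surjective β
  have hv' : Ideal.Quotient.mk (maximalIdeal R) v * 2 = 1 := by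
    rw [← map_ofNat (Ideal.Quotient.mk (maximalIdeal R)) 2, ← map_mul, hv, map_one]
  have hf : f.Monic := by
    rw [show f = Polynomial.X ^ 2 + (-Polynomial.C t * Polynomial.X + Polynomial.C δ) by
      simp only [f]; ring]
    refine Polynomial.monic_X_pow_add ?_
    rw [← Polynomial.C_neg]
    exact (Polynomial.degree_linear_le).trans_lt (by norm_num)
  have unit_of : ∀ x : R, Ideal.Quotient.mk (maximalIdeal R) x ≠ 0 → IsUnit x := fun x hx => by
    by_contra hu
    exact hx (Ideal.Quotient.eq_zero_iff_mem.2 ((mem_maximalIdeal _).2 hu))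
  have hder : IsUnit (f.derivative.eval a) := by
    refine unit_of _ ?_
    simp [f, ht]
    contrapose! hαβ
    linear_combination hαβ
  obtain ⟨l, hl, hla⟩ := HenselianRing.is_henselian (I := maximalIdeal R) f hf a (by
    rw [← Ideal.Quotient.eq_zero_iff_mem]
    simp [f, δ, ht, hs]
    linear_combination (Ideal.Quotient.mk (maximalIdeal R) a *
      Ideal.Quotient.mk (maximalIdeal R) a') * hv')
    (hder.map _)
  rw [Polynomial.IsRoot.def] at hl
  simp [f, δ] at hl
  rw [← Ideal.Quotient.mk_eq_mk_iff_sub_mem] at hla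
  refine ⟨l, t - l, unit_of _ ?_, by ring, ?_⟩
  · rw [map_sub, map_sub, ht, hla]
    contrapose! hαβ
    linear_combination hαβ
  · linear_combination -2 * hl + (t ^ 2 - s) * hv

/-- For a matrix representation `(A B; C D)` which is diagonal with residually distinct entries at
some element, the trace splits as a sum of two characters modulo `I` iff all products `B g * C h`
lie in `I`. -/
lemma exists_characters_iff {G : Type*} [Group G] (h2 : IsUnit (2 : R)) {A B C D : G → R}
    (hA1 : A 1 = 1) (hD1 : D 1 = 1)
    (hA : ∀ g h, A (g * h) = A g * A h + B g * C h) (hD : ∀ g h, D (g * h) = C g * B h + D g * D h)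
    {g₀ : G} (hu : IsUnit (A g₀ - D g₀)) (hB0 : B g₀ = 0) (hC0 : C g₀ = 0) {I : Ideal R}
    (hI : I ≠ ⊤) :
    (∃ ϑ ϑ' : G →* (R ⧸ I)ˣ,
      ∀ g, Ideal.Quotient.mk I (A g + D g) = (ϑ g : R ⧸ I) + (ϑ' g : R ⧸ I)) ↔
    ∀ g h, B g * C h ∈ I := by
  constructor
  · rintro ⟨ϑ, ϑ', h⟩
    have : Nontrivial (R ⧸ I) := Ideal.Quotient.nontrivial_iff.2 hI
    have : IsLocalRing (R ⧸ I) := .of_surjective' _ Ideal.Quotient.mk_surjective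
    have h2' : IsUnit (2 : R ⧸ I) := by
      rw [← map_ofNat (Ideal.Quotient.mk I) 2]
      exact h2.map _
    have hu' := hu.map (Ideal.Quotient.mk I)
    have key : ∀ ϑ ϑ' : G →* (R ⧸ I)ˣ,
        (∀ g, Ideal.Quotient.mk I (A g + D g) = (ϑ g : R ⧸ I) + (ϑ' g : R ⧸ I)) →
        (ϑ g₀ : R ⧸ I) = Ideal.Quotient.mk I (A g₀) → ∀ g h, B g * C h ∈ I := by
      intro ϑ ϑ' h h₀ g k
      have hϑ : ∀ g, (ϑ g : R ⧸ I) = Ideal.Quotient.mk I (A g) := by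
        intro g
        refine hu'.mul_left_cancel ?_
        have e₁ := h g
        have e₀ := h g₀
        have e₂ := h (g₀ * g)
        rw [hA, hD, hB0, hC0, map_mul, map_mul] at e₂
        push_cast [map_add, map_sub, map_mul, map_zero] at e₀ e₁ e₂ ⊢
        rw [h₀] at e₀ e₂
        linear_combination -e₂ + Ideal.Quotient.mk I (D g₀) * e₁ + (ϑ' g : R ⧸ I) * e₀
      have e := hϑ (g * k)
      rw [map_mul, Units.val_mul, hϑ, hϑ, hA, map_add, map_mul] at e
      rw [← Ideal.Quotient.eq_zero_iff_mem]
      linear_combination -e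
    have e₁ := h g₀
    have e₂ := h (g₀ * g₀)
    rw [hA, hD, hB0, hC0, map_mul, map_mul] at e₂
    push_cast [map_add, map_mul, map_zero] at e₁ e₂
    have hprod : ((ϑ g₀ : R ⧸ I) - Ideal.Quotient.mk I (A g₀)) *
        ((ϑ' g₀ : R ⧸ I) - Ideal.Quotient.mk I (A g₀)) = 0 := by
      refine h2'.mul_left_cancel ?_
      linear_combination (-(ϑ g₀ : R ⧸ I) - (ϑ' g₀ : R ⧸ I) - Ideal.Quotient.mk I (D g₀)
        + Ideal.Quotient.mk I (A g₀)) * e₁ + e₂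
    have hsum : IsUnit (((ϑ g₀ : R ⧸ I) - Ideal.Quotient.mk I (A g₀)) +
        ((ϑ' g₀ : R ⧸ I) - Ideal.Quotient.mk I (A g₀))) := by
      convert hu'.neg using 1
      rw [map_sub]
      linear_combination -e₁
    rcases IsLocalRing.isUnit_or_isUnit_of_isUnit_add hsum with hunit | hunit
    · refine key ϑ' ϑ (fun g => (h g).trans (add_comm _ _)) (sub_eq_zero.1 ?_)
      exact hunit.mul_right_eq_zero.1 hprod
    · exact key ϑ ϑ' h (sub_eq_zero.1 (hunit.mul_left_eq_zero.1 hprod))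
  · intro h
    have h0 : ∀ g k, Ideal.Quotient.mk I (B g) * Ideal.Quotient.mk I (C k) = 0 := fun g k => by
      rw [← map_mul, Ideal.Quotient.eq_zero_iff_mem]
      exact h g k
    let a : G →* R ⧸ I :=
      { toFun := fun g => Ideal.Quotient.mk I (A g)
        map_one' := by rw [hA1, map_one]
        map_mul' := fun g k => by rw [hA, map_add, map_mul, map_mul, h0, add_zero] }
    let e : G →* R ⧸ I :=
      { toFun := fun g => Ideal.Quotient.mk I (D g)
        map_one' := by rw [hD1, map_one]
        map_mul' := fun g k => by rw [hD, map_add, map_mul, map_mul, mul_comm, h0, zero_add] }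
    exact ⟨a.toHomUnits, e.toHomUnits, fun g => map_add _ _ _⟩

end Reducibility

section NormalizedBasis

variable {R K V G : Type*} [CommRing R] [Field K] [Algebra R K]
  [AddCommGroup V] [Module K V] [Module R V] [IsScalarTower R K V] [Group G]

lemma repr_zero_smul_mem {b : Module.Basis (Fin 2) K V} {f : V →ₗ[K] V} {l m : R}
    (h0 : f (b 0) = l • b 0) (h1 : f (b 1) = m • b 1) (hu : IsUnit (l - m)) {T : Submodule R V}
    (hT : ∀ w ∈ T, f w ∈ T) {w : V} (hw : w ∈ T) : b.repr w 0 • b 0 ∈ T := by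
  obtain ⟨c, hc⟩ := hu.exists_left_inv
  have key : b.repr w 0 • b 0 = c • (f w - m • w) := by
    have h : f w - m • w = (l - m) • b.repr w 0 • b 0 := by
      have hw := b.sum_repr w
      rw [Fin.sum_univ_two] at hw
      nth_rw 1 2 [← hw]
      simp only [map_add, map_smul, h0, h1, ← algebraMap_smul (R := R) K]
      module
    rw [h, smul_smul, hc, one_smul]
  rw [key]
  exact T.smul_mem _ (T.sub_mem (hT w hw) (T.smul_mem _ hw))

/-- `ρ` has the integral matrix `!![A, B; C, D]` in the basis `b`. -/
def HasMatrix (ρ : Representation K G V) (b : Module.Basis (Fin 2) K V) (A B C D : G → R) : Prop :=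
  ∀ g, ρ g (b 0) = A g • b 0 + C g • b 1 ∧ ρ g (b 1) = B g • b 0 + D g • b 1

variable {ρ : Representation K G V} {b : Module.Basis (Fin 2) K V} {A B C D : G → R}

lemma smul_add_smul_inj [FaithfulSMul R K] {x y x' y' : R}
    (h : x • b 0 + y • b 1 = x' • b 0 + y' • b 1) : x = x' ∧ y = y' := by
  have hinj := FaithfulSMul.algebraMap_injective R K
  have h0 := congrArg (fun w => b.repr w 0) h
  have h1 := congrArg (fun w => b.repr w 1) h
  simp only [map_add, Finsupp.add_apply, repr_smul_of_tower, Module.Basis.repr_self] at h0 h1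
  exact ⟨hinj (by simpa using h0), hinj (by simpa using h1)⟩

namespace HasMatrix

lemma one [FaithfulSMul R K] (h : HasMatrix ρ b A B C D) : A 1 = 1 ∧ D 1 = 1 := by
  have h0 : (1 : R) • b 0 + (0 : R) • b 1 = A 1 • b 0 + C 1 • b 1 := by
    rw [← (h 1).1]; simp
  have h1 : (0 : R) • b 0 + (1 : R) • b 1 = B 1 • b 0 + D 1 • b 1 := by
    rw [← (h 1).2]; simp
  exact ⟨(smul_add_smul_inj h0).1.symm, (smul_add_smul_inj h1).2.symm⟩

lemma mul [FaithfulSMul R K] (h : HasMatrix ρ b A B C D) (g k : G) :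
    A (g * k) = A g * A k + B g * C k ∧ D (g * k) = C g * B k + D g * D k := by
  have h0 : A (g * k) • b 0 + C (g * k) • b 1 =
      (A g * A k + B g * C k) • b 0 + (C g * A k + D g * C k) • b 1 := by
    rw [← (h (g * k)).1, map_mul, Module.End.mul_apply, (h k).1]
    simp only [← algebraMap_smul (R := R) K, map_add, map_smul, map_mul]
    rw [(h g).1, (h g).2]
    simp only [← algebraMap_smul (R := R) K]
    module
  have h1 : B (g * k) • b 0 + D (g * k) • b 1 =
      (A g * B k + B g * D k) • b 0 + (C g * B k + D g * D k) • b 1 := by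
    rw [← (h (g * k)).2, map_mul, Module.End.mul_apply, (h k).2]
    simp only [← algebraMap_smul (R := R) K, map_add, map_smul, map_mul]
    rw [(h g).1, (h g).2]
    simp only [← algebraMap_smul (R := R) K]
    module
  exact ⟨(smul_add_smul_inj h0).1, (smul_add_smul_inj h1).2⟩

lemma trace (h : HasMatrix ρ b A B C D) (g : G) :
    LinearMap.trace K V (ρ g) = algebraMap R K (A g + D g) := by
  rw [LinearMap.trace_eq_matrix_trace K b, Matrix.trace_fin_two, LinearMap.toMatrix_apply,
    LinearMap.toMatrix_apply, (h g).1, (h g).2]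
  simp [repr_smul_of_tower]

/-- The `(2,1)` and `(1,2)` entries of an irreducible representation do not vanish identically. -/
lemma exists_ne_zero (h : HasMatrix ρ b A B C D)
    (hirr : ∀ W : Submodule K V, (∀ g : G, ∀ v ∈ W, ρ g v ∈ W) → W = ⊥ ∨ W = ⊤) :
    (∃ g, B g ≠ 0) ∧ ∃ g, C g ≠ 0 := by
  have key : ∀ i j : Fin 2, i ≠ j → ∀ X : G → R, ¬ ∀ g, ρ g (b i) = X g • b i := by
    intro i j hij X hX
    have hstab : ∀ g, ∀ v ∈ Submodule.span K {b i}, ρ g v ∈ Submodule.span K {b i} := by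
      intro g v hv
      obtain ⟨c, rfl⟩ := Submodule.mem_span_singleton.1 hv
      rw [map_smul, hX, ← algebraMap_smul (R := R) K]
      exact Submodule.smul_mem _ _ (Submodule.smul_mem _ _ (Submodule.mem_span_singleton_self _))
    rcases hirr _ hstab with h | h
    · exact b.ne_zero i (Submodule.span_singleton_eq_bot.1 h)
    · have hj : b j ∈ Submodule.span K {b i} := h ▸ Submodule.mem_top
      obtain ⟨c, hc⟩ := Submodule.mem_span_singleton.1 hj
      have := congrArg (fun w => b.repr w j) hc
      simp [hij] at this
  constructor
  · by_contra! h0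
    exact key 1 0 (by decide) D fun g => by simp [(h g).2, h0]
  · by_contra! h0
    exact key 0 1 (by decide) A fun g => by simp [(h g).1, h0]

/-- Rescaling the second basis vector. -/
lemma exists_rescale (h : HasMatrix ρ b A B C D) {β : R} (hβ : algebraMap R K β ≠ 0) {B' : G → R}
    (hB' : ∀ g, B g = β * B' g) :
    ∃ b' : Module.Basis (Fin 2) K V, HasMatrix ρ b' A B' (fun g => β * C g) D := by
  let b' := b.unitsSMul ![1, (Units.mk0 _ hβ)⁻¹]
  have hb0 : b' 0 = b 0 := by simp [b', Module.Basis.unitsSMul_apply]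
  have hb1 : b' 1 = (algebraMap R K β)⁻¹ • b 1 := by
    simp [b', Module.Basis.unitsSMul_apply, Units.smul_def]
  refine ⟨b', fun g => ?_⟩
  rw [hb0, hb1, map_smul, (h g).1, (h g).2, hB']
  simp only [← algebraMap_smul (R := R) K, map_mul, smul_add, smul_smul]
  constructor
  · congr 2
    field_simp
  · congr 2
    · field_simp
    · ring

end HasMatrix

omit [Algebra R K] [IsScalarTower R K V] in
/-- A stable diagonal lattice gives an integral matrix. -/
lemma exists_hasMatrix_of_stable {e : Module.Basis (Fin 2) K V} {u v : K} (hu : u ≠ 0)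
    (hv : v ≠ 0) (hst : ∀ g, ∀ w ∈ diagLattice R e u v, ρ g w ∈ diagLattice R e u v) :
    ∃ A B C D : G → R, HasMatrix ρ (e.unitsSMul ![Units.mk0 u hu, Units.mk0 v hv]) A B C D := by
  have hb0 : e.unitsSMul ![Units.mk0 u hu, Units.mk0 v hv] 0 = u • e 0 := by
    simp [Module.Basis.unitsSMul_apply, Units.smul_def]
  have hb1 : e.unitsSMul ![Units.mk0 u hu, Units.mk0 v hv] 1 = v • e 1 := by
    simp [Module.Basis.unitsSMul_apply, Units.smul_def]
  have h0 : ∀ g, ∃ x y : R, x • u • e 0 + y • v • e 1 = ρ g (u • e 0) := fun g =>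
    Submodule.mem_span_pair.1 (hst g _ (Submodule.subset_span (by simp)))
  have h1 : ∀ g, ∃ x y : R, x • u • e 0 + y • v • e 1 = ρ g (v • e 1) := fun g =>
    Submodule.mem_span_pair.1 (hst g _ (Submodule.subset_span (by simp)))
  choose A C hAC using h0
  choose B D hBD using h1
  exact ⟨A, B, C, D, fun g => by rw [hb0, hb1, hAC, hBD]; exact ⟨rfl, rfl⟩⟩

end NormalizedBasis

section StableLattices

variable {R K V G : Type*} [CommRing R] [IsDomain R] [IsLocalRing R]
  [UniqueFactorizationMonoid R] [Field K] [Algebra R K] [IsFractionRing R K]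
  [AddCommGroup V] [Module K V] [Module R V] [IsScalarTower R K V] [Group G]
  {ρ : Representation K G V} {b : Module.Basis (Fin 2) K V} {A B C D : G → R} {d : R}

variable (ρ) in
/-- The stable free lattices of `ρ`. -/
def IsStableFreeLattice (T : Submodule R V) : Prop :=
  T.FG ∧ Submodule.span K (T : Set V) = ⊤ ∧ (∀ g : G, ∀ v ∈ T, ρ g v ∈ T) ∧ Module.Free R T

omit [IsDomain R] [UniqueFactorizationMonoid R] in
/-- An element of `G` with distinct residual characters has an integral eigenbasis. -/
lemma exists_integral_eigenbasis [IsAdicComplete (maximalIdeal R) R] (h2 : IsUnit (2 : R))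
    (hdim : Module.finrank K V = 2) {tr : G → R}
    (htr : ∀ g, algebraMap R K (tr g) = LinearMap.trace K V (ρ g))
    {ψ ψ' : G →* (R ⧸ maximalIdeal R)ˣ} (hdist : ψ ≠ ψ')
    (hred : ∀ g, Ideal.Quotient.mk (maximalIdeal R) (tr g)
      = (ψ g : R ⧸ maximalIdeal R) + (ψ' g : R ⧸ maximalIdeal R)) :
    ∃ (g : G) (l m : R) (e : Module.Basis (Fin 2) K V),
      IsUnit (l - m) ∧ ρ g (e 0) = l • e 0 ∧ ρ g (e 1) = m • e 1 := by
  obtain ⟨g, hg⟩ := DFunLike.ne_iff.1 hdist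
  have hg' : (ψ g : R ⧸ maximalIdeal R) ≠ ψ' g := fun h => hg (Units.ext h)
  obtain ⟨l, m, hu, ht, hs⟩ := exists_lift_roots h2 hg' (hred g) (s := tr (g * g))
    (by rw [hred]; simp [sq])
  have hlm : algebraMap R K l ≠ algebraMap R K m := fun h =>
    hu.ne_zero (sub_eq_zero.2 (FaithfulSMul.algebraMap_injective R K h))
  obtain ⟨e, h0, h1⟩ := exists_eigenbasis hdim (ρ g) hlm
    (by rw [← map_ofNat (algebraMap R K) 2]; exact (h2.map _).ne_zero) (by rw [← htr, ht, map_add])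
    (by
      have h := htr (g * g)
      rw [map_mul, hs] at h
      rw [← Module.End.mul_eq_comp, ← h, map_add, map_pow, map_pow])
  exact ⟨g, l, m, e, hu, by simpa using h0, by simpa using h1⟩

/-- A basis in which `ρ` is integral, one group element is diagonal with residually distinct
eigenvalues, and the upper right entries have no common divisor. -/
lemma exists_normalized_basis [IsAdicComplete (maximalIdeal R) R] (h2 : IsUnit (2 : R))
    (hdim : Module.finrank K V = 2)
    (hirr : ∀ W : Submodule K V, (∀ g : G, ∀ v ∈ W, ρ g v ∈ W) → W = ⊥ ∨ W = ⊤)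
    {T₀ : Submodule R V} (hT₀ : IsStableFreeLattice ρ T₀) {tr : G → R}
    (htr : ∀ g, algebraMap R K (tr g) = LinearMap.trace K V (ρ g))
    {ψ ψ' : G →* (R ⧸ maximalIdeal R)ˣ} (hdist : ψ ≠ ψ')
    (hred : ∀ g, Ideal.Quotient.mk (maximalIdeal R) (tr g)
      = (ψ g : R ⧸ maximalIdeal R) + (ψ' g : R ⧸ maximalIdeal R)) :
    ∃ (b : Module.Basis (Fin 2) K V) (A B C D : G → R) (g₀ : G), HasMatrix ρ b A B C D ∧
      IsUnit (A g₀ - D g₀) ∧ B g₀ = 0 ∧ C g₀ = 0 ∧ ∀ x, (∀ g, x ∣ B g) → IsUnit x := by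
  obtain ⟨g₀, l, m, e, hu, he0, he1⟩ := exists_integral_eigenbasis h2 hdim htr hdist hred
  obtain ⟨hfg, hspan, hstab, hfree⟩ := hT₀
  obtain ⟨u, v, hu0, hv0, rfl⟩ := exists_eq_diagLattice (b := e) hfg hspan hfree
    fun w => repr_zero_smul_mem he0 he1 hu (hstab g₀)
  obtain ⟨A, B, C, D, hM⟩ := exists_hasMatrix_of_stable hu0 hv0 hstab
  obtain ⟨hB, -⟩ := hM.exists_ne_zero hirr
  obtain ⟨β, hβ0, hβ, hβmax⟩ := exists_gcd_family B hB
  choose B' hB' using hβ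
  have hβK : algebraMap R K β ≠ 0 := by simpa using hβ0
  have hg0 : A g₀ = l ∧ C g₀ = 0 := by
    refine smul_add_smul_inj (b := e.unitsSMul ![Units.mk0 u hu0, Units.mk0 v hv0]) ?_
    rw [← (hM g₀).1]
    simp [Module.Basis.unitsSMul_apply, Units.smul_def, he0, smul_comm u l]
  have hg1 : B g₀ = 0 ∧ D g₀ = m := by
    refine smul_add_smul_inj (b := e.unitsSMul ![Units.mk0 u hu0, Units.mk0 v hv0]) ?_
    rw [← (hM g₀).2]
    simp [Module.Basis.unitsSMul_apply, Units.smul_def, he1, smul_comm v m]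
  obtain ⟨b, hb⟩ := hM.exists_rescale hβK hB'
  refine ⟨b, A, B', fun g => β * C g, D, g₀, hb, by rwa [hg0.1, hg1.2], ?_, by simp [hg0.2],
    fun x hx => ?_⟩
  · have h := hB' g₀
    rw [hg1.1] at h
    exact (mul_eq_zero.1 h.symm).resolve_left hβ0
  · have h : β * x ∣ β * 1 := by
      rw [mul_one]
      exact hβmax _ fun g => by rw [hB' g]; exact mul_dvd_mul_left β (hx g)
    exact isUnit_of_dvd_one ((mul_dvd_mul_iff_left hβ0).1 h)

namespace HasMatrix

/-- In a normalized basis, the stable free lattices are, up to homothety, the lattices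
`R e₀ + R x e₁` with `x` a common divisor of the lower left entries. -/
lemma isStableFreeLattice_iff (h : HasMatrix ρ b A B C D) {g₀ : G} (hu : IsUnit (A g₀ - D g₀))
    (hB0 : B g₀ = 0) (hC0 : C g₀ = 0) (hB : ∀ x, (∀ g, x ∣ B g) → IsUnit x) (hd : d ≠ 0)
    (hdC : ∀ x, x ∣ d ↔ ∀ g, x ∣ C g) {T : Submodule R V} :
    IsStableFreeLattice ρ T ↔
      ∃ x, x ∣ d ∧ ∃ a : K, a ≠ 0 ∧ T = diagLattice R b a (a * algebraMap R K x) := by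
  constructor
  · rintro ⟨hfg, hspan, hstab, hfree⟩
    obtain ⟨u, v, hu0, hv0, rfl⟩ := exists_eq_diagLattice (b := b) hfg hspan hfree
      fun w => repr_zero_smul_mem (by simpa [hC0] using (h g₀).1) (by simpa [hB0] using (h g₀).2)
        hu (hstab g₀)
    obtain ⟨y, rfl⟩ : ∃ y, v = u * y := ⟨u⁻¹ * v, by field_simp⟩
    have key := fun g => diagLattice_stable_imp (h g).1 (h g).2 hu0 (hstab g)
    obtain ⟨x, s, hxs, rfl⟩ := IsFractionRing.exists_reduced_fraction (A := R) y
    have hs0 : algebraMap R K s ≠ 0 := by simp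
    have hs : IsUnit (s : R) := by
      refine hB _ fun g => ?_
      obtain ⟨k, hk⟩ := (key g).1
      rw [IsFractionRing.mk'_eq_div, mul_div_assoc', div_eq_iff hs0, ← map_mul, ← map_mul] at hk
      have hk' := FaithfulSMul.algebraMap_injective R K hk
      exact hxs.symm.dvd_of_dvd_mul_right (Dvd.intro_left _ hk'.symm)
    obtain ⟨t, ht⟩ := hs.exists_left_inv
    have hxt : IsLocalization.mk' K x s = algebraMap R K (x * t) := by
      rw [IsFractionRing.mk'_eq_div, div_eq_iff hs0, ← map_mul, mul_assoc, ht, mul_one]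
    rw [hxt] at key ⊢
    refine ⟨_, (hdC _).2 fun g => ?_, u, hu0, rfl⟩
    obtain ⟨k, hk⟩ := (key g).2
    rw [← map_mul] at hk
    exact Dvd.intro_left k (FaithfulSMul.algebraMap_injective R K hk).symm
  · rintro ⟨x, hx, a, ha, rfl⟩
    have hx0 : a * algebraMap R K x ≠ 0 :=
      mul_ne_zero ha (by simpa using ne_zero_of_dvd_ne_zero hd hx)
    exact ⟨diagLattice_fg _ _, span_diagLattice ha hx0,
      fun g => diagLattice_stable (h g).1 (h g).2 a ((hdC x).1 hx g), diagLattice_free ha hx0⟩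

omit [UniqueFactorizationMonoid R] in
/-- The ideal of reducibility and `d` have the same order at every prime. -/
lemma le_span_pow_iff (h : HasMatrix ρ b A B C D) (h2 : IsUnit (2 : R)) {g₀ : G}
    (hu : IsUnit (A g₀ - D g₀)) (hB0 : B g₀ = 0) (hC0 : C g₀ = 0)
    (hB : ∀ x, (∀ g, x ∣ B g) → IsUnit x) (hdC : ∀ x, x ∣ d ↔ ∀ g, x ∣ C g) {tr : G → R}
    (htr : ∀ g, algebraMap R K (tr g) = LinearMap.trace K V (ρ g)) {J : Ideal R}
    (hJ : ∀ I : Ideal R, J ≤ I ↔ ∃ ϑ ϑ' : G →* (R ⧸ I)ˣ,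
      ∀ g, Ideal.Quotient.mk I (tr g) = (ϑ g : R ⧸ I) + (ϑ' g : R ⧸ I))
    {s : R} (hs : Prime s) {k : ℕ} (hk : k ≠ 0) : J ≤ Ideal.span {s} ^ k ↔ s ^ k ∣ d := by
  have htr' : ∀ g, tr g = A g + D g := fun g =>
    FaithfulSMul.algebraMap_injective R K (by rw [htr, h.trace])
  have hI : Ideal.span {s ^ k} ≠ ⊤ := by
    rw [Ne, Ideal.span_singleton_eq_top, isUnit_pow_iff hk]
    exact hs.not_isUnit
  rw [Ideal.span_singleton_pow, hJ]
  simp only [htr']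
  rw [exists_characters_iff h2 h.one.1 h.one.2 (fun g k => (h.mul g k).1) (fun g k => (h.mul g k).2)
    hu hB0 hC0 hI]
  simp only [Ideal.mem_span_singleton, hdC]
  constructor
  · intro hBC
    have hsB : ∃ g, ¬ s ∣ B g := by
      by_contra! hsB
      exact hs.not_isUnit (hB s hsB)
    obtain ⟨g, hg⟩ := hsB
    exact fun k' => hs.pow_dvd_of_dvd_mul_left _ hg (hBC g k')
  · exact fun hC g k' => (hC k').mul_left _

end HasMatrix

end StableLattices

/-- rectangle structure theorem. Let `R` be a complete local UFD of
residue characteristic `≠ 2` and `ρ` a two-dimensional irreducible representation with a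
stable free lattice and residually disjoint reducible reduction. Let `J` be the ideal of
reducibility, `p 1, …, p r` the height-one primes where `J` is locally proper, and
`n i = ord_{p i} J_{p i}`. Then the graph `C^fr(ρ)` of homothety classes of stable free
lattices is isomorphic to the `r`-dimensional rectangle `∏ᵢ {0, …, n i}` with edges given
by coordinates differing by `1` in one place. (When `r = 0` the rectangle is a single
point.) -/
theorem rectangle_structure
    {R K V G : Type*} [CommRing R] [IsDomain R] [IsLocalRing R]
    [UniqueFactorizationMonoid R] [IsAdicComplete (maximalIdeal R) R]
    [Field K] [Algebra R K] [IsFractionRing R K]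
    [AddCommGroup V] [Module K V] [Module R V] [IsScalarTower R K V] [Group G]
    (hchar : ringChar (R ⧸ maximalIdeal R) ≠ 2)
    (hdim : Module.finrank K V = 2)
    (ρ : Representation K G V)
    (hirr : ∀ W : Submodule K V, (∀ g : G, ∀ v ∈ W, ρ g v ∈ W) → W = ⊥ ∨ W = ⊤)
    (T₀ : Submodule R V) (hT₀fg : T₀.FG) (hT₀span : Submodule.span K (T₀ : Set V) = ⊤)
    (hT₀stab : ∀ g : G, ∀ v ∈ T₀, ρ g v ∈ T₀) (hT₀free : Module.Free R T₀)
    (tr : G → R) (htr : ∀ g, algebraMap R K (tr g) = LinearMap.trace K V (ρ g))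
    (ψ ψ' : G →* (R ⧸ maximalIdeal R)ˣ) (hdist : ψ ≠ ψ')
    (hred : ∀ g, Ideal.Quotient.mk (maximalIdeal R) (tr g)
      = (ψ g : R ⧸ maximalIdeal R) + (ψ' g : R ⧸ maximalIdeal R))
    (J : Ideal R)
    (hJ : ∀ I : Ideal R, J ≤ I ↔ ∃ ϑ ϑ' : G →* (R ⧸ I)ˣ,
      ∀ g, Ideal.Quotient.mk I (tr g) = (ϑ g : R ⧸ I) + (ϑ' g : R ⧸ I))
    (r : ℕ) (p : Fin r → Ideal R) (hpinj : Function.Injective p)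
    (hp : ∀ i, IsHeightOnePrime (p i))
    (hN : ∀ q : Ideal R, IsHeightOnePrime q → (J ≤ q ↔ ∃ i, q = p i))
    (n : Fin r → ℕ) (hnpos : ∀ i, 1 ≤ n i)
    (hord : ∀ i, J ≤ (p i) ^ (n i) ∧ ¬ J ≤ (p i) ^ (n i + 1)) :
    ∃ Φ : Submodule R V → (∀ i, Fin (n i + 1)),
      (∀ T T' : Submodule R V,
        (T.FG ∧ Submodule.span K (T : Set V) = ⊤ ∧ (∀ g : G, ∀ v ∈ T, ρ g v ∈ T) ∧
          Module.Free R T) →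
        (T'.FG ∧ Submodule.span K (T' : Set V) = ⊤ ∧ (∀ g : G, ∀ v ∈ T', ρ g v ∈ T') ∧
          Module.Free R T') →
        (Φ T = Φ T' ↔ Homothetic R K T T')) ∧
      (∀ j : ∀ i, Fin (n i + 1), ∃ T : Submodule R V,
        T.FG ∧ Submodule.span K (T : Set V) = ⊤ ∧ (∀ g : G, ∀ v ∈ T, ρ g v ∈ T) ∧
          Module.Free R T ∧ Φ T = j) ∧
      (∀ T T' : Submodule R V,
        (T.FG ∧ Submodule.span K (T : Set V) = ⊤ ∧ (∀ g : G, ∀ v ∈ T, ρ g v ∈ T) ∧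
          Module.Free R T) →
        (T'.FG ∧ Submodule.span K (T' : Set V) = ⊤ ∧ (∀ g : G, ∀ v ∈ T', ρ g v ∈ T') ∧
          Module.Free R T') →
        ((EdgeLat R K T T' ∨ EdgeLat R K T' T) ↔ RectAdj (Φ T) (Φ T'))) := by

  classical
  have h2 := isUnit_two_of_ringChar_ne_two hchar
  obtain ⟨b, A, B, C, D, g₀, hM, hu, hB0, hC0, hB⟩ := exists_normalized_basis h2 hdim hirr
    ⟨hT₀fg, hT₀span, hT₀stab, hT₀free⟩ htr hdist hred
  obtain ⟨d, hd, hdC, hdmax⟩ := exists_gcd_family C (hM.exists_ne_zero hirr).2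
  have hdC' : ∀ x, x ∣ d ↔ ∀ g, x ∣ C g := fun x => ⟨fun h g => h.trans (hdC g), hdmax x⟩
  have hlat := fun T => hM.isStableFreeLattice_iff hu hB0 hC0 hB hd hdC' (T := T)
  have hJd : ∀ s, Prime s → ∀ k ≠ 0, (J ≤ Ideal.span {s} ^ k ↔ s ^ k ∣ d) := fun s hs k hk =>
    hM.le_span_pow_iff h2 hu hB0 hC0 hB hdC' htr hJ hs hk
  choose π hπ hpπ using fun i => (hp i).exists_eq_span
  have hdn : ∀ i, π i ^ n i ∣ d ∧ ¬ π i ^ (n i + 1) ∣ d := fun i => by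
    rw [← hJd _ (hπ i) _ (Nat.one_le_iff_ne_zero.1 (hnpos i)),
      ← hJd _ (hπ i) _ (Nat.succ_ne_zero _), ← hpπ i]
    exact hord i
  have hπi : ∀ i j, Associated (π i) (π j) → i = j := fun i j hij =>
    hpinj (by rw [hpπ, hpπ, Ideal.span_singleton_eq_span_singleton.2 hij])
  have hdp : ∀ q, Prime q → q ∣ d → ∃ i, Associated q (π i) := fun q hq hqd => by
    obtain ⟨i, hi⟩ := (hN _ (isHeightOnePrime_span_singleton hq)).1
      (by simpa using (hJd q hq 1 one_ne_zero).2 (by simpa using hqd))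
    exact ⟨i, Ideal.span_singleton_eq_span_singleton.1 (hi.trans (hpπ i))⟩
  have hdn' := fun i => (hdn i).2
  have hdvd0 : ∀ {x}, x ∣ d → x ≠ 0 := fun h => ne_zero_of_dvd_ne_zero hd h
  let ratio : Submodule R V → R := fun T =>
    if h : ∃ x, x ∣ d ∧ ∃ a : K, a ≠ 0 ∧ T = diagLattice R b a (a * algebraMap R K x)
    then h.choose else 1
  have hratio : ∀ T, IsStableFreeLattice ρ T → ratio T ∣ d ∧ ∃ a : K, a ≠ 0 ∧
      T = diagLattice R b a (a * algebraMap R K (ratio T)) := fun T hT => by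
    have h := (hlat T).1 hT
    simp only [ratio, dif_pos h]
    exact h.choose_spec
  refine ⟨fun T => truncMultiplicity π n (ratio T), fun T T' hT hT' => ?_, fun j => ?_,
    fun T T' hT hT' => ?_⟩
  · obtain ⟨hx, a, ha, hTa⟩ := hratio T hT
    obtain ⟨hx', a', ha', hTa'⟩ := hratio T' hT'
    rw [truncMultiplicity_eq_iff hπ hd hdn' hdp hx hx',
      ← homothetic_diagLattice_iff (b := b) ha ha', ← hTa, ← hTa']
  · obtain ⟨x, hx, rfl⟩ := exists_truncMultiplicity_eq hπ hπi hd hdn j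
    let T := diagLattice R b 1 (1 * algebraMap R K x)
    have hT : IsStableFreeLattice ρ T := (hlat T).2 ⟨x, hx, 1, one_ne_zero, rfl⟩
    obtain ⟨hx', a, ha, hTa⟩ := hratio T hT
    refine ⟨T, hT.1, hT.2.1, hT.2.2.1, hT.2.2.2, ?_⟩
    rw [truncMultiplicity_eq_iff hπ hd hdn' hdp hx' hx,
      ← homothetic_diagLattice_iff (b := b) ha one_ne_zero, ← hTa]
    exact (homothetic_diagLattice_iff one_ne_zero one_ne_zero).2 (.refl x)
  · obtain ⟨hx, a, ha, hTa⟩ := hratio T hT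
    obtain ⟨hx', a', ha', hTa'⟩ := hratio T' hT'
    rw [rectAdj_truncMultiplicity_iff hπ hπi hd hdn' hdp hx hx',
      ← edgeLat_diagLattice_iff (b := b) ha ha' (hdvd0 hx) (hdvd0 hx'), ← hTa, ← hTa']
end
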